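/- arXiv:0902.1738 — 5 statements merged into one kernel-verified Lean document; each statement's English description precedes it below -/
import Mathlib

section
/- Let F be a finite field with |F| ≥ 4 and let x be an element of PSL(2, F) whose order is an odd prime. Then there exists g ∈ PSL(2, F) such that the subgroup ⟨x, g⁻¹xg⟩ generated by x and its conjugate is not solvable. -/
open Matrix
open scoped MatrixGroups

theorem Subgroup.exists_comm_normalized_of_isSolvable {G : Type*} [Group G] {H : Subgroup G}
    (hH : Group.IsSolvable H) (hne : H ≠ ⊥) :
    ∃ N : Subgroup G, (∀ h ∈ H, ∀ n ∈ N, h * n * h⁻¹ ∈ N) ∧ (∃ m ∈ N, m ≠ 1) ∧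
      ∀ a ∈ N, ∀ b ∈ N, Commute a b := by
  classical
  obtain ⟨k, hk, hk'⟩ : ∃ k, derivedSeries H k ≠ ⊥ ∧ derivedSeries H (k + 1) = ⊥ := by
    have hex := hH.solvable
    have h0 : Nat.find hex ≠ 0 := by
      intro h
      have := Nat.find_spec hex
      rw [h, derivedSeries_zero] at this
      exact hne ((Subgroup.eq_bot_iff_forall H).mpr fun a ha => by
        have h1 : (⟨a, ha⟩ : H) ∈ (⊤ : Subgroup H) := Subgroup.mem_top _
        rw [this, Subgroup.mem_bot] at h1
        exact congrArg Subtype.val h1)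
    obtain ⟨k, hk⟩ := Nat.exists_eq_succ_of_ne_zero h0
    exact ⟨k, Nat.find_min hex (by omega), by
      have := Nat.find_spec hex
      rwa [hk] at this⟩
  refine ⟨(derivedSeries H k).map H.subtype, ?_, ?_, ?_⟩
  · rintro h hh _ ⟨n, hn, rfl⟩
    exact ⟨⟨h, hh⟩ * n * ⟨h, hh⟩⁻¹, (derivedSeries_normal H k).conj_mem n hn _, rfl⟩
  · obtain ⟨m, hm, hm1⟩ := (Subgroup.bot_or_exists_ne_one _).resolve_left hk
    exact ⟨m, ⟨m, hm, rfl⟩, fun h => hm1 (Subtype.ext h)⟩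
  · rintro _ ⟨a, ha, rfl⟩ _ ⟨b, hb, rfl⟩
    have := Subgroup.commutator_mem_commutator ha hb
    rw [← derivedSeries_succ, hk', Subgroup.mem_bot, commutatorElement_eq_one_iff_commute] at this
    exact this.map H.subtype

set_option maxRecDepth 4000 in
/-- Two elements of odd order permuting three elements by conjugation act through `A₃`. -/
theorem exists_commute_of_conj_fin_three {G : Type*} [Group G] {e : Fin 3 → G}
    (he : Function.Injective e) {x y : G} {n : ℕ} (hn : Odd n) (hxn : x ^ n = 1) (hyn : y ^ n = 1)
    (hx : ∀ a, ∃ b, x * e a * x⁻¹ = e b) (hy : ∀ a, ∃ b, y * e a * y⁻¹ = e b) :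
    (∀ a, Commute (x ^ 3) (e a)) ∧ ((∀ a, Commute x (e a)) ∨ (∀ a, Commute y (e a)) ∨
      (∀ a, Commute (x * y) (e a)) ∨ ∀ a, Commute (x * y⁻¹) (e a)) := by
  have perm (z : G) (hz : ∀ a, ∃ b, z * e a * z⁻¹ = e b) :
      ∃ σ : Equiv.Perm (Fin 3), ∀ a, z * e a * z⁻¹ = e (σ a) := by
    choose f hf using hz
    have hinj : Function.Injective f := fun a b hab => he <| by
      have := (hf a).trans ((congrArg e hab).trans (hf b).symm)
      simpa using this
    exact ⟨Equiv.ofBijective f (Finite.injective_iff_bijective.mp hinj), hf⟩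
  have hmul (z w : G) (σ τ : Equiv.Perm (Fin 3)) (hz : ∀ a, z * e a * z⁻¹ = e (σ a))
      (hw : ∀ a, w * e a * w⁻¹ = e (τ a)) (a : Fin 3) :
      (z * w) * e a * (z * w)⁻¹ = e ((σ * τ) a) := by
    rw [Equiv.Perm.mul_apply, ← hz, ← hw]; group
  have hinv (z : G) (σ : Equiv.Perm (Fin 3)) (hz : ∀ a, z * e a * z⁻¹ = e (σ a)) (a : Fin 3) :
      z⁻¹ * e a * z⁻¹⁻¹ = e (σ⁻¹ a) := by
    have := hz (σ⁻¹ a)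
    rw [show σ (σ⁻¹ a) = a from σ.apply_symm_apply a] at this
    rw [← this]; group
  have hpow (z : G) (σ : Equiv.Perm (Fin 3)) (hz : ∀ a, z * e a * z⁻¹ = e (σ a)) (k : ℕ) :
      ∀ a, z ^ k * e a * (z ^ k)⁻¹ = e ((σ ^ k) a) := by
    induction k with
    | zero => simp
    | succ k ih => rw [pow_succ, pow_succ]; exact hmul _ _ _ _ ih hz
  have hone (z : G) (hz : ∀ a, z * e a * z⁻¹ = e ((1 : Equiv.Perm (Fin 3)) a)) (a : Fin 3) :
      Commute z (e a) := by
    have := hz a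
    rw [Equiv.Perm.one_apply, mul_inv_eq_iff_eq_mul] at this
    exact this
  have cube (z : G) (σ : Equiv.Perm (Fin 3)) (hz : ∀ a, z * e a * z⁻¹ = e (σ a))
      (hzn : z ^ n = 1) : σ ^ 3 = 1 := by
    have h1 : σ ^ n = 1 := Equiv.ext fun a => he <| by
      rw [← hpow z σ hz n a, hzn]; simp
    have h6 : ∀ σ : Equiv.Perm (Fin 3), (σ ^ 3) ^ 2 = 1 := by decide
    obtain ⟨k, rfl⟩ := hn
    have h2 : (σ ^ 3) ^ (2 * k + 1) = 1 := by rw [← pow_mul, mul_comm, pow_mul, h1, one_pow]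
    rwa [pow_succ, pow_mul, h6, one_pow, one_mul] at h2
  obtain ⟨σ, hσ⟩ := perm x hx
  obtain ⟨τ, hτ⟩ := perm y hy
  have hσ3 := cube x σ hσ hxn
  have hτ3 := cube y τ hτ hyn
  refine ⟨hone _ (hσ3 ▸ hpow x σ hσ 3), ?_⟩
  have key : ∀ σ τ : Equiv.Perm (Fin 3), σ ^ 3 = 1 → τ ^ 3 = 1 →
      σ = 1 ∨ τ = 1 ∨ σ * τ = 1 ∨ σ * τ⁻¹ = 1 := by decide
  rcases key σ τ hσ3 hτ3 with h | h | h | h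
  · exact .inl (hone _ (h ▸ hσ))
  · exact .inr (.inl (hone _ (h ▸ hτ)))
  · exact .inr (.inr (.inl (hone _ (h ▸ hmul _ _ _ _ hσ hτ))))
  · exact .inr (.inr (.inr (hone _ (h ▸ hmul _ _ _ _ hσ (hinv _ _ hτ)))))

theorem exists_sq_avoiding {F : Type*} [Field F] [Fintype F] (hF : 4 ≤ Fintype.card F) (t : F) :
    ∃ v : F, v ≠ 0 ∧ v ^ 2 ≠ t ^ 2 - 4 ∧ (t ^ 2 = 1 → v ^ 2 ≠ -1 ∧ v ^ 2 ≠ -2) := by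
  classical
  have root (P : Polynomial F) (h0 : P ≠ 0) (h : P.natDegree < Fintype.card F) :
      ∃ v, P.eval v ≠ 0 := by
    by_contra! hc
    exact h0 (Polynomial.eq_zero_of_natDegree_lt_card_of_eval_eq_zero P
      Function.injective_id hc h)
  by_cases ht : t ^ 2 = 1
  · by_cases h2 : (2 : F) = 0
    · obtain ⟨v, hv, hv1⟩ : ∃ v : F, v ≠ 0 ∧ v ≠ 1 := by
        obtain ⟨v, hv⟩ := Finset.exists_mem_notMem_of_card_lt_card (s := {0, 1})
          (t := (Finset.univ : Finset F)) (by
            rw [Finset.card_univ]; exact (Finset.card_le_two).trans_lt (by omega))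
        exact ⟨v, by simpa using hv⟩
      have : v ^ 2 ≠ 1 := fun h => hv1 (by
        have : (v - 1) ^ 2 = 0 := by linear_combination h - (v - 1) * h2
        exact sub_eq_zero.mp (pow_eq_zero_iff (by norm_num) |>.mp this))
      exact ⟨v, hv, by grind, fun _ => ⟨by grind, by grind⟩⟩
    · by_cases h3 : (3 : F) = 0
      · have hcard : 5 < Fintype.card F := by
          have : Fact (Nat.Prime 3) := ⟨by norm_num⟩
          have : CharP F 3 := (CharP.charP_iff_prime_eq_zero Fact.out).mpr (by exact_mod_cast h3)
          obtain ⟨n, -, hn⟩ := FiniteField.card F 3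
          rw [hn] at hF ⊢
          have : 2 ≤ (n : ℕ) := by
            by_contra! h
            have : (n : ℕ) = 1 := by have := n.pos; omega
            rw [this] at hF; omega
          calc 5 < 3 ^ 2 := by norm_num
            _ ≤ _ := Nat.pow_le_pow_right (by norm_num) this
        obtain ⟨v, hv⟩ := root (Polynomial.X ^ 5 - Polynomial.X)
          (Polynomial.Monic.ne_zero (by monicity!))
          (lt_of_le_of_lt (b := 5) (by compute_degree!) hcard)
        simp at hv
        exact ⟨v, by grind, by grind, fun _ => ⟨by grind, by grind⟩⟩
      · have h4 : (4 : F) ≠ 0 := by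
          rw [show (4 : F) = 2 * 2 by norm_num]; exact mul_ne_zero h2 h2
        exact ⟨1, one_ne_zero, by grind, fun _ => ⟨by grind, by grind⟩⟩
  · obtain ⟨v, hv⟩ := root (Polynomial.X ^ 3 - Polynomial.C (t ^ 2 - 4) * Polynomial.X)
      (Polynomial.Monic.ne_zero (by monicity!)) (lt_of_le_of_lt (b := 3) (by compute_degree!) hF)
    simp at hv
    exact ⟨v, by grind, by grind, fun h => absurd h ht⟩
section TwoByTwo

variable {F : Type*} [Field F]

theorem Matrix.exists_eq_smul_one_add_smul_of_commute {M X : Matrix (Fin 2) (Fin 2) F}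
    (hM : ¬(M 0 1 = 0 ∧ M 1 0 = 0 ∧ M 0 0 = M 1 1)) (h : Commute X M) :
    ∃ a b : F, X = a • 1 + b • M := by
  have h00 := congrFun₂ h.eq 0 0
  have h01 := congrFun₂ h.eq 0 1
  have h10 := congrFun₂ h.eq 1 0
  simp only [mul_apply, Fin.sum_univ_two] at h00 h01 h10
  suffices ∃ a b : F, X 0 0 = a + b * M 0 0 ∧ X 0 1 = b * M 0 1 ∧ X 1 0 = b * M 1 0 ∧
      X 1 1 = a + b * M 1 1 by
    obtain ⟨a, b, h1, h2, h3, h4⟩ := this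
    refine ⟨a, b, ?_⟩
    ext i j
    fin_cases i <;> fin_cases j <;> simp [*]
  by_cases h1 : M 0 1 = 0
  · by_cases h2 : M 1 0 = 0
    · have h3 : M 0 0 - M 1 1 ≠ 0 := sub_ne_zero.mpr fun h3 => hM ⟨h1, h2, h3⟩
      refine ⟨X 0 0 - (X 0 0 - X 1 1) / (M 0 0 - M 1 1) * M 0 0,
        (X 0 0 - X 1 1) / (M 0 0 - M 1 1), ?_, ?_, ?_, ?_⟩ <;> field_simp <;> grind
    · refine ⟨X 0 0 - X 1 0 / M 1 0 * M 0 0, X 1 0 / M 1 0, ?_, ?_, ?_, ?_⟩ <;> field_simp <;> grind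
  · refine ⟨X 0 0 - X 0 1 / M 0 1 * M 0 0, X 0 1 / M 0 1, ?_, ?_, ?_, ?_⟩ <;> field_simp <;> grind

theorem Matrix.commute_of_commute_nonscalar {M X Y : Matrix (Fin 2) (Fin 2) F}
    (hM : ¬(M 0 1 = 0 ∧ M 1 0 = 0 ∧ M 0 0 = M 1 1)) (hX : Commute X M) (hY : Commute Y M) :
    Commute X Y := by
  obtain ⟨a, b, rfl⟩ := exists_eq_smul_one_add_smul_of_commute hM hX
  exact ((Commute.one_left Y).smul_left a).add_left (hY.symm.smul_left b)

theorem Matrix.eq_or_eq_adjugate_of_commute {M X : Matrix (Fin 2) (Fin 2) F}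
    (hM : ¬(M 0 1 = 0 ∧ M 1 0 = 0 ∧ M 0 0 = M 1 1)) (h : Commute X M)
    (hMd : M.det = 1) (hXd : X.det = 1) (htr : X.trace = M.trace) (ht : M.trace ^ 2 ≠ 4) :
    X = M ∨ X = M.adjugate := by
  obtain ⟨a, b, rfl⟩ := exists_eq_smul_one_add_smul_of_commute hM h
  have hb : b = 1 ∧ a = 0 ∨ b = -1 ∧ a = M.trace := by
    simp only [det_fin_two, trace_fin_two, add_apply, smul_apply, one_apply_eq, smul_eq_mul, ne_eq,
      zero_ne_one, one_ne_zero, not_false_eq_true, one_apply_ne, mul_one, mul_zero, zero_add]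
      at hMd hXd htr ht ⊢
    have h1 : (1 - b) * (1 + b) * ((M 0 0 + M 1 1) ^ 2 - 4) = 0 := by grind
    have h2 : b = 1 ∨ b = -1 := by grind
    rcases h2 with rfl | rfl
    · by_cases ha : a = 0
      · exact .inl ⟨rfl, ha⟩
      · have h0 : (2 : F) = 0 :=
          (mul_eq_zero.mp (by linear_combination htr : (2 : F) * a = 0)).resolve_right ha
        have h3 : a * (a + (M 0 0 + M 1 1)) = 0 := by linear_combination hXd - hMd
        have h4 := (mul_eq_zero.mp h3).resolve_left ha
        exact .inr ⟨by linear_combination h0, by linear_combination h4 - (M 0 0 + M 1 1) * h0⟩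
    · by_cases ha : a = M 0 0 + M 1 1
      · exact .inr ⟨rfl, ha⟩
      · have h0 : (2 : F) = 0 :=
          (mul_eq_zero.mp (by linear_combination htr :
            (2 : F) * (a - (M 0 0 + M 1 1)) = 0)).resolve_right (sub_ne_zero.mpr ha)
        have h3 : a * (a - (M 0 0 + M 1 1)) = 0 := by linear_combination hXd - hMd
        have h4 := (mul_eq_zero.mp h3).resolve_right (sub_ne_zero.mpr ha)
        exact .inl ⟨by linear_combination -h0, h4⟩
  rcases hb with ⟨rfl, rfl⟩ | ⟨rfl, rfl⟩
  · left; simp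
  · right
    ext i j
    fin_cases i <;> fin_cases j <;> simp [adjugate_fin_two, trace_fin_two]

set_option linter.unnecessarySeqFocus false in
theorem Matrix.exists_eigenvector_of_trace_sq_eq_four {M : Matrix (Fin 2) (Fin 2) F}
    (hM : ¬(M 0 1 = 0 ∧ M 1 0 = 0 ∧ M 0 0 = M 1 1)) (hMd : M.det = 1) (ht : M.trace ^ 2 = 4) :
    ∃ (v : Fin 2 → F) (l : F), v ≠ 0 ∧ M *ᵥ v = l • v ∧
      ∀ (w : Fin 2 → F) (m : F), M *ᵥ w = m • w → ∃ c : F, w = c • v := by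
  have hl : ∃ l : F, 2 * l = M.trace ∧ l ^ 2 = 1 := by
    have : (M.trace - 2) * (M.trace + 2) = 0 := by linear_combination ht
    rcases mul_eq_zero.mp this with h | h
    · exact ⟨1, by linear_combination -h, by norm_num⟩
    · exact ⟨-1, by linear_combination -h, by norm_num⟩
  obtain ⟨l, hl, hl2⟩ := hl
  rw [det_fin_two] at hMd
  rw [trace_fin_two] at hl
  have eig (w : Fin 2 → F) (m : F) (hw : M *ᵥ w = m • w) :
      (M 0 0 - l) * w 0 + M 0 1 * w 1 = 0 ∧ M 1 0 * w 0 + (M 1 1 - l) * w 1 = 0 := by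
    have h0 := congrFun hw 0
    have h1 := congrFun hw 1
    simp only [mulVec, dotProduct, Fin.sum_univ_two, Pi.smul_apply, smul_eq_mul] at h0 h1
    have e0 : (m - l) ^ 2 * w 0 = 0 := by grind
    have e1 : (m - l) ^ 2 * w 1 = 0 := by grind
    by_cases hm : m = l
    · grind
    · have : (m - l) ^ 2 ≠ 0 := pow_ne_zero _ (sub_ne_zero.mpr hm)
      have e0 := (mul_eq_zero.mp e0).resolve_left this
      have e1 := (mul_eq_zero.mp e1).resolve_left this
      simp [e0, e1]
  by_cases h01 : M 0 1 = 0
  · have h10 : M 1 0 ≠ 0 := fun h10 => hM ⟨h01, h10, by grind⟩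
    refine ⟨![l - M 1 1, M 1 0], l, fun h => h10 (by simpa using congrFun h 1), ?_, ?_⟩
    · ext i
      fin_cases i <;> simp [mulVec, dotProduct, Fin.sum_univ_two] <;> grind
    · intro w m hw
      obtain ⟨e0, e1⟩ := eig w m hw
      refine ⟨w 1 / M 1 0, ?_⟩
      ext i
      fin_cases i <;> simp <;> field_simp <;> grind
  · refine ⟨![M 0 1, l - M 0 0], l, fun h => h01 (by simpa using congrFun h 0), ?_, ?_⟩
    · ext i
      fin_cases i <;> simp [mulVec, dotProduct, Fin.sum_univ_two] <;> grind
    · intro w m hw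
      obtain ⟨e0, e1⟩ := eig w m hw
      refine ⟨w 0 / M 0 1, ?_⟩
      ext i
      fin_cases i <;> simp <;> field_simp <;> grind

namespace Matrix.SpecialLinearGroup

theorem not_scalar {M : SL(2, F)} (h1 : M ≠ 1) (h2 : M ≠ -1) :
    ¬(M 0 1 = 0 ∧ M 1 0 = 0 ∧ M 0 0 = M 1 1) := by
  rintro ⟨h01, h10, h⟩
  have hd := M.det_coe
  rw [det_fin_two, h01, h10, ← h] at hd
  have : (M 0 0 - 1) * (M 0 0 + 1) = 0 := by linear_combination hd
  rcases mul_eq_zero.mp this with h' | h'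
  · refine h1 (ext _ _ fun i j => ?_)
    fin_cases i <;> fin_cases j <;> simp <;> grind
  · refine h2 (ext _ _ fun i j => ?_)
    fin_cases i <;> fin_cases j <;> simp <;> grind

theorem commute_coe {A B : SL(2, F)} :
    Commute (A : Matrix (Fin 2) (Fin 2) F) (B : Matrix (Fin 2) (Fin 2) F) ↔ Commute A B :=
  ⟨fun h => Subtype.ext h, fun h => congrArg Subtype.val h⟩

theorem mk_eq_one_iff {A : SL(2, F)} :
    (A : PSL(2, F)) = 1 ↔ A = 1 ∨ A = -1 := by
  rw [QuotientGroup.eq_one_iff]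
  constructor
  · intro h
    obtain ⟨r, hr, hA⟩ := mem_center_iff.mp h
    by_contra! hc
    exact not_scalar hc.1 hc.2 (by simp [← hA])
  · rintro (rfl | rfl)
    · exact one_mem _
    · exact Subgroup.mem_center_iff.mpr fun g => by simp

theorem mk_eq_mk_iff {A B : SL(2, F)} :
    (A : PSL(2, F)) = B ↔ A = B ∨ A = -B := by
  rw [← mul_inv_eq_one, ← QuotientGroup.mk_inv, ← QuotientGroup.mk_mul, mk_eq_one_iff,
    mul_inv_eq_one, mul_inv_eq_iff_eq_mul, neg_one_mul]

theorem commute_mk_iff {A B : SL(2, F)} :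
    Commute (A : PSL(2, F)) (B : PSL(2, F)) ↔ Commute A B ∨ A * B = -(B * A) :=
  mk_eq_mk_iff (A := A * B) (B := B * A)

theorem mk_eq_one_of_commute {C I J : SL(2, F)} (hIJ : ¬ Commute I J) (hI : Commute C I)
    (hJ : Commute C J) : (C : PSL(2, F)) = 1 := by
  rw [mk_eq_one_iff]
  by_contra! hc
  exact hIJ (commute_coe.mp (commute_of_commute_nonscalar (not_scalar hc.1 hc.2)
    (commute_coe.mpr hI.symm) (commute_coe.mpr hJ.symm)))

theorem trace_eq_zero_of_anticommute (h2 : (2 : F) ≠ 0) {C I : SL(2, F)}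
    (h : C * I = -(I * C)) : trace (C : Matrix (Fin 2) (Fin 2) F) = 0 := by
  have h' : C = -(I * C * I⁻¹) := by
    rw [← neg_mul, ← h, mul_inv_cancel_right]
  have := congrArg (fun X : SL(2, F) => trace (X : Matrix (Fin 2) (Fin 2) F)) h'
  simp only [coe_neg, coe_mul, trace_neg] at this
  rw [trace_mul_cycle, ← coe_mul, inv_mul_cancel, coe_one, one_mul] at this
  have : 2 * trace (C : Matrix (Fin 2) (Fin 2) F) = 0 := by linear_combination this
  exact (mul_eq_zero.mp this).resolve_left h2

theorem sq_eq_neg_one_of_trace_eq_zero {C : SL(2, F)}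
    (h : trace (C : Matrix (Fin 2) (Fin 2) F) = 0) : C ^ 2 = -1 := by
  have hd := C.det_coe
  rw [det_fin_two] at hd
  rw [trace_fin_two] at h
  ext i j
  fin_cases i <;> fin_cases j <;>
    simp [pow_two, mul_apply, Fin.sum_univ_two] <;> grind

theorem trace_mul_inv (A B : SL(2, F)) :
    trace ((A * B⁻¹ : SL(2, F)) : Matrix (Fin 2) (Fin 2) F) =
      trace (A : Matrix (Fin 2) (Fin 2) F) * trace (B : Matrix (Fin 2) (Fin 2) F) -
        trace ((A * B : SL(2, F)) : Matrix (Fin 2) (Fin 2) F) := by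
  simp [trace_fin_two, mul_apply, adjugate_fin_two, Fin.sum_univ_two]
  ring

theorem trace_sq_eq_one_of_cube {A : SL(2, F)} (h1 : (A : PSL(2, F)) ≠ 1)
    (h : ((A ^ 3 : SL(2, F)) : PSL(2, F)) = 1) :
    trace (A : Matrix (Fin 2) (Fin 2) F) ^ 2 = 1 := by
  by_contra ht
  rw [ne_eq, mk_eq_one_iff, not_or] at h1
  refine not_scalar h1.1 h1.2 ?_
  have hd := A.det_coe
  rw [det_fin_two] at hd
  rw [trace_fin_two] at ht
  have ht' := sub_ne_zero.mpr ht
  suffices ((A ^ 3) 0 1 = 0 ∧ (A ^ 3) 1 0 = 0 ∧ (A ^ 3) 0 0 = (A ^ 3) 1 1) by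
    simp only [pow_succ, pow_zero, one_mul, coe_mul, mul_apply, Fin.sum_univ_two] at this
    obtain ⟨e1, e2, e3⟩ := this
    refine ⟨?_, ?_, sub_eq_zero.mp ?_⟩ <;> apply (mul_eq_zero.mp _).resolve_left ht'
    · linear_combination e1 + A 0 1 * hd
    · linear_combination e2 + A 1 0 * hd
    · linear_combination e3 + (A 0 0 - A 1 1) * hd
  rcases mk_eq_one_iff.mp h with h | h <;> rw [h] <;> simp

theorem commute_of_mk_eq_one {A : SL(2, F)} (h : (A : PSL(2, F)) = 1) (B : SL(2, F)) :
    Commute A B := by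
  rcases mk_eq_one_iff.mp h with rfl | rfl
  · exact Commute.one_left _
  · exact Commute.neg_one_left _

/-- A normalized abelian group all of whose lifts commute forces a common torus or a common
eigenvector. -/
theorem det_commutator_eq_zero_of_conj_commute {A B M : SL(2, F)} (hM1 : (M : PSL(2, F)) ≠ 1)
    {n : ℕ} (hn : Odd n) (hAn : (A : PSL(2, F)) ^ n = 1) (hBn : (B : PSL(2, F)) ^ n = 1)
    (hA : Commute (A * M * A⁻¹) M) (hA' : Commute (A⁻¹ * M * A) M)
    (hB : Commute (B * M * B⁻¹) M) (hB' : Commute (B⁻¹ * M * B) M) :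
    (A * B - B * A : Matrix (Fin 2) (Fin 2) F).det = 0 := by
  rw [ne_eq, mk_eq_one_iff, not_or] at hM1
  have hns := not_scalar hM1.1 hM1.2
  by_cases ht : trace (M : Matrix (Fin 2) (Fin 2) F) ^ 2 = 4
  · obtain ⟨v, l, hv, hvl, hspan⟩ := exists_eigenvector_of_trace_sq_eq_four hns M.det_coe ht
    have key (C : SL(2, F)) (hC : Commute (C⁻¹ * M * C) M) :
        ∃ c : F, (C : Matrix (Fin 2) (Fin 2) F) *ᵥ v = c • v := by
      obtain ⟨a, b, hab⟩ := exists_eq_smul_one_add_smul_of_commute hns (commute_coe.mpr hC)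
      refine hspan _ (a + b * l) ?_
      have : (M * C : SL(2, F)) = C * (C⁻¹ * M * C) := by group
      have := congrArg (fun X : SL(2, F) => (X : Matrix (Fin 2) (Fin 2) F)) this
      rw [coe_mul, coe_mul C, hab] at this
      rw [mulVec_mulVec, this, ← mulVec_mulVec, add_mulVec, smul_mulVec, smul_mulVec, one_mulVec,
        hvl, smul_smul, ← add_smul, mulVec_smul]
    obtain ⟨c, hc⟩ := key A hA'
    obtain ⟨d, hd⟩ := key B hB'
    refine exists_mulVec_eq_zero_iff.mp ⟨v, hv, ?_⟩
    rw [sub_mulVec, ← mulVec_mulVec, ← mulVec_mulVec, hc, hd, mulVec_smul, mulVec_smul, hc, hd,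
      smul_comm, sub_self]
  · have key (C : SL(2, F)) (hC : Commute (C * M * C⁻¹) M) (hCn : (C : PSL(2, F)) ^ n = 1) :
        Commute C M := by
      have h2 : Commute (C ^ 2) M := by
        have htr : trace ((C * M * C⁻¹ : SL(2, F)) : Matrix (Fin 2) (Fin 2) F) =
            trace (M : Matrix (Fin 2) (Fin 2) F) := by
          rw [coe_mul, coe_mul, trace_mul_cycle, ← coe_mul, inv_mul_cancel, coe_one, one_mul]
        have := eq_or_eq_adjugate_of_commute hns (commute_coe.mpr hC) M.det_coe (det_coe _) htr ht
        rw [← coe_inv] at this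
        have h : C * M * C⁻¹ = M ∨ C * M * C⁻¹ = M⁻¹ := this.imp Subtype.ext Subtype.ext
        have h' : C * (C * M * C⁻¹) * C⁻¹ = M := by
          rcases h with h | h
          · rw [h, h]
          · rw [h]
            simpa [mul_assoc] using congrArg (·⁻¹) h
        rw [pow_two, Commute, SemiconjBy, ← mul_inv_eq_iff_eq_mul]
        refine Eq.trans ?_ h'
        group
      obtain ⟨k, rfl⟩ := hn
      have h3 : Commute (C ^ (2 * k + 1)) M := by
        rw [← QuotientGroup.mk_pow] at hCn
        exact commute_of_mk_eq_one hCn M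
      have h4 : C = C ^ (2 * k + 1) * ((C ^ 2) ^ k)⁻¹ := by
        rw [eq_mul_inv_iff_mul_eq, ← pow_mul, ← pow_succ']
      rw [h4]
      exact h3.mul_left (h2.pow_left k).inv_left
    rw [(commute_of_commute_nonscalar hns (commute_coe.mpr (key A hA hAn))
      (commute_coe.mpr (key B hB hBn))).eq, sub_self]
    simp

theorem two_ne_zero_of_anticommute {I J : SL(2, F)} (hIJ : I * J = -(J * I))
    (hcomm : ¬ Commute I J) : (2 : F) ≠ 0 := by
  intro h2
  have hneg (X : SL(2, F)) : -X = X := by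
    ext i j
    have : -X i j = X i j := by linear_combination (-X i j) * h2
    simpa using this
  exact hcomm (hIJ.trans (hneg _))

theorem mk_eq_one_of_trace_eq_zero_of_odd {C : SL(2, F)} {n : ℕ} (hn : Odd n)
    (hCn : (C : PSL(2, F)) ^ n = 1) (h : trace (C : Matrix (Fin 2) (Fin 2) F) = 0) :
    (C : PSL(2, F)) = 1 := by
  have hsq : (C : PSL(2, F)) ^ 2 = 1 := by
    rw [← QuotientGroup.mk_pow, mk_eq_one_iff]
    exact .inr (sq_eq_neg_one_of_trace_eq_zero h)
  obtain ⟨k, rfl⟩ := hn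
  rwa [pow_succ, pow_mul, hsq, one_pow, one_mul] at hCn

/-- Elements of odd order normalizing a four-group act on it through a cyclic group of order
three, which restricts their traces. -/
theorem trace_mul_of_normalizes_anticommuting {A B I J : SL(2, F)} (hIJ : I * J = -(J * I))
    (hcomm : ¬ Commute I J) {N : Subgroup PSL(2, F)} (hN : ∀ a ∈ N, ∀ b ∈ N, Commute a b)
    (hI : (I : PSL(2, F)) ∈ N) (hJ : (J : PSL(2, F)) ∈ N)
    {n : ℕ} (hn : Odd n) (hAn : (A : PSL(2, F)) ^ n = 1) (hBn : (B : PSL(2, F)) ^ n = 1)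
    (hA1 : (A : PSL(2, F)) ≠ 1) (hB1 : (B : PSL(2, F)) ≠ 1)
    (hA : ∀ m ∈ N, (A : PSL(2, F)) * m * (A : PSL(2, F))⁻¹ ∈ N)
    (hB : ∀ m ∈ N, (B : PSL(2, F)) * m * (B : PSL(2, F))⁻¹ ∈ N)
    (hAB : ¬ Commute (A : PSL(2, F)) B) :
    trace (A : Matrix (Fin 2) (Fin 2) F) ^ 2 = 1 ∧
      (trace (A * B : Matrix (Fin 2) (Fin 2) F) = 0 ∨
        trace (A * B : Matrix (Fin 2) (Fin 2) F) =
          trace (A : Matrix (Fin 2) (Fin 2) F) * trace (B : Matrix (Fin 2) (Fin 2) F)) := by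
  have h2 := two_ne_zero_of_anticommute hIJ hcomm
  have cent (C : SL(2, F)) (hCI : Commute (C : PSL(2, F)) (I : PSL(2, F)))
      (hCJ : Commute (C : PSL(2, F)) (J : PSL(2, F))) :
      (C : PSL(2, F)) = 1 ∨ trace (C : Matrix (Fin 2) (Fin 2) F) = 0 := by
    rcases commute_mk_iff.mp hCI with h | h
    · rcases commute_mk_iff.mp hCJ with h' | h'
      · exact .inl (mk_eq_one_of_commute hcomm h h')
      · exact .inr (trace_eq_zero_of_anticommute h2 h')
    · exact .inr (trace_eq_zero_of_anticommute h2 h)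
  have cent_odd (C : SL(2, F)) (hCn : (C : PSL(2, F)) ^ n = 1)
      (hCI : Commute (C : PSL(2, F)) (I : PSL(2, F)))
      (hCJ : Commute (C : PSL(2, F)) (J : PSL(2, F))) : (C : PSL(2, F)) = 1 := by
    exact (cent C hCI hCJ).elim id fun h => mk_eq_one_of_trace_eq_zero_of_odd hn hCn h
  have hsqI : (I : PSL(2, F)) ^ 2 = 1 := by
    rw [← QuotientGroup.mk_pow, mk_eq_one_iff]
    exact .inr (sq_eq_neg_one_of_trace_eq_zero (trace_eq_zero_of_anticommute h2 hIJ))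
  have hJI : J * I = -(I * J) := by rw [hIJ, neg_neg]
  have hsqJ : (J : PSL(2, F)) ^ 2 = 1 := by
    rw [← QuotientGroup.mk_pow, mk_eq_one_iff]
    exact .inr (sq_eq_neg_one_of_trace_eq_zero (trace_eq_zero_of_anticommute h2 hJI))
  rw [pow_two] at hsqI hsqJ
  have hI1 : (I : PSL(2, F)) ≠ 1 := by
    intro h
    exact hcomm (commute_of_mk_eq_one h J)
  have hJ1 : (J : PSL(2, F)) ≠ 1 := by
    intro h
    exact hcomm (commute_of_mk_eq_one h I).symm
  have hIneJ : (I : PSL(2, F)) ≠ J := by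
    intro h
    rcases mk_eq_mk_iff.mp h with h | h <;> rw [h] at hcomm
    · exact hcomm (Commute.refl _)
    · exact hcomm (Commute.refl J).neg_left
  set e : Fin 3 → PSL(2, F) := ![(I : PSL(2, F)), (J : PSL(2, F)), I * J] with he
  have he_inj : Function.Injective e := by
    intro a b
    fin_cases a <;> fin_cases b <;> simp [he, hI1, hJ1, hIneJ, hIneJ.symm]
  have he_mem (a : Fin 3) : e a ∈ N := by
    fin_cases a
    · exact hI
    · exact hJ
    · exact mul_mem hI hJ
  have he_ne (a : Fin 3) : e a ≠ 1 := by
    fin_cases a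
    · exact hI1
    · exact hJ1
    · intro h
      have h : (I : PSL(2, F)) * J = 1 := h
      exact hIneJ (mul_right_cancel (h.trans hsqJ.symm))
  have he_surj (m : PSL(2, F)) (hm : m ∈ N) (hm1 : m ≠ 1) : ∃ b, m = e b := by
    induction m using QuotientGroup.induction_on with | _ C
    have aux (D : SL(2, F)) (E : PSL(2, F)) (hE : E * E = 1) (hD : Commute D I ∧ Commute D J)
        (hDE : (D : PSL(2, F)) = (C : PSL(2, F)) * E) : (C : PSL(2, F)) = E := by
      have := mk_eq_one_of_commute hcomm hD.1 hD.2
      rw [hDE, ← hE] at this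
      exact mul_right_cancel this
    rcases commute_mk_iff.mp (hN _ hm _ hI) with h | h <;>
      rcases commute_mk_iff.mp (hN _ hm _ hJ) with h' | h'
    · exact absurd (mk_eq_one_of_commute hcomm h h') hm1
    · refine ⟨0, aux (C * I) I hsqI ⟨h.mul_left (.refl I), ?_⟩ rfl⟩
      rw [Commute, SemiconjBy, mul_assoc, hIJ, mul_neg, ← mul_assoc, h', neg_mul, neg_neg,
        mul_assoc]
    · refine ⟨1, aux (C * J) J hsqJ ⟨?_, h'.mul_left (.refl J)⟩ rfl⟩
      rw [Commute, SemiconjBy, mul_assoc, hJI, mul_neg, ← mul_assoc, h, neg_mul, neg_neg,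
        mul_assoc]
    · refine ⟨2, aux (C * (I * J)) (I * J) ?_ ⟨?_, ?_⟩ rfl⟩
      · have := (hN _ hI _ hJ).eq
        calc (I * J * (I * J) : PSL(2, F)) = I * (J * I) * J := by group
          _ = (I * I) * (J * J) := by rw [← this]; group
          _ = 1 := by rw [hsqI, hsqJ, one_mul]
      · rw [Commute, SemiconjBy]
        calc C * (I * J) * I = C * I * (J * I) := by group
          _ = I * (C * (I * J)) := by rw [h, hJI]; simp [mul_assoc]
      · rw [Commute, SemiconjBy]
        calc C * (I * J) * J = C * (I * J) * J := by group
          _ = C * J * -(I * J) := by rw [hIJ]; simp only [mul_assoc, neg_mul, mul_neg, neg_neg, hIJ]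
          _ = J * (C * (I * J)) := by rw [h']; simp only [mul_assoc, neg_mul, mul_neg, neg_neg]
  have hperm (X : PSL(2, F)) (hX : ∀ m ∈ N, X * m * X⁻¹ ∈ N) (a : Fin 3) :
      ∃ b, X * e a * X⁻¹ = e b :=
    he_surj _ (hX _ (he_mem a)) fun h => he_ne a (by simpa [mul_inv_eq_one] using h)
  obtain ⟨hcube, hor⟩ := exists_commute_of_conj_fin_three he_inj hn hAn hBn
    (hperm _ hA) (hperm _ hB)
  constructor
  · refine trace_sq_eq_one_of_cube hA1 (cent_odd _ ?_ (hcube 0) (hcube 1))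
    rw [QuotientGroup.mk_pow, ← pow_mul, mul_comm, pow_mul, hAn, one_pow]
  rcases hor with h | h | h | h
  · exact absurd (cent_odd A hAn (h 0) (h 1)) hA1
  · exact absurd (cent_odd B hBn (h 0) (h 1)) hB1
  · refine .inl ((cent (A * B) (h 0) (h 1)).resolve_left fun h => hAB ?_)
    have h : (A : PSL(2, F)) * B = 1 := h
    rw [eq_inv_of_mul_eq_one_left h]
    exact (Commute.refl _).inv_left
  · refine .inr ?_
    have := (cent (A * B⁻¹) (h 0) (h 1)).resolve_left fun h => hAB ?_
    · rw [trace_mul_inv, coe_mul] at this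
      linear_combination -this
    · have h : (A : PSL(2, F)) * (B : PSL(2, F))⁻¹ = 1 := h
      rw [mul_inv_eq_one.mp h]

/-- Two elements of odd order of `PSL(2, F)` generate a non-solvable group as soon as the traces of
their lifts exclude a common eigenvector, a common torus, and the normalizer of a four-group. -/
theorem not_isSolvable_closure_pair {A B : SL(2, F)} {n : ℕ} (hn : Odd n)
    (hAn : (A : PSL(2, F)) ^ n = 1) (hBn : (B : PSL(2, F)) ^ n = 1)
    (hdet : (A * B - B * A : Matrix (Fin 2) (Fin 2) F).det ≠ 0)
    (htr : trace (A : Matrix (Fin 2) (Fin 2) F) ^ 2 = 1 →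
      trace (A * B : Matrix (Fin 2) (Fin 2) F) ≠ 0 ∧
        trace (A * B : Matrix (Fin 2) (Fin 2) F) ≠
          trace (A : Matrix (Fin 2) (Fin 2) F) * trace (B : Matrix (Fin 2) (Fin 2) F)) :
    ¬ Group.IsSolvable (Subgroup.closure {(A : PSL(2, F)), (B : PSL(2, F))}) := by
  intro hsol
  have hcomm : ¬ Commute A B := fun h => hdet (by rw [(commute_coe.mpr h).eq]; simp)
  have hA1 : (A : PSL(2, F)) ≠ 1 := fun h => hcomm (commute_of_mk_eq_one h B)
  have hB1 : (B : PSL(2, F)) ≠ 1 := fun h => hcomm (commute_of_mk_eq_one h A).symm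
  have hAB : ¬ Commute (A : PSL(2, F)) B := by
    intro h
    have h := (commute_mk_iff.mp h).resolve_left hcomm
    exact hA1 (mk_eq_one_of_trace_eq_zero_of_odd hn hAn
      (trace_eq_zero_of_anticommute (two_ne_zero_of_anticommute h hcomm) h))
  have hAmem : (A : PSL(2, F)) ∈ Subgroup.closure {(A : PSL(2, F)), (B : PSL(2, F))} :=
    Subgroup.subset_closure (by simp)
  have hBmem : (B : PSL(2, F)) ∈ Subgroup.closure {(A : PSL(2, F)), (B : PSL(2, F))} :=
    Subgroup.subset_closure (by simp)
  obtain ⟨N, hnorm, ⟨m, hm, hm1⟩, hN⟩ := Subgroup.exists_comm_normalized_of_isSolvable hsol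
    fun h => hA1 (Subgroup.mem_bot.mp (h ▸ hAmem))
  by_cases hlift : ∀ I J : SL(2, F), (I : PSL(2, F)) ∈ N → (J : PSL(2, F)) ∈ N → Commute I J
  · induction m using QuotientGroup.induction_on with | _ M
    have conj (C : SL(2, F)) (hC : (C : PSL(2, F)) ∈
        Subgroup.closure {(A : PSL(2, F)), (B : PSL(2, F))}) : Commute (C * M * C⁻¹) M :=
      hlift _ _ (hnorm _ hC _ hm) hm
    refine hdet (det_commutator_eq_zero_of_conj_commute hm1 hn hAn hBn (conj A hAmem) ?_
      (conj B hBmem) ?_)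
    · simpa using conj A⁻¹ (inv_mem hAmem)
    · simpa using conj B⁻¹ (inv_mem hBmem)
  · push Not at hlift
    obtain ⟨I, J, hI, hJ, hIJ⟩ := hlift
    obtain ⟨h1, h2⟩ := trace_mul_of_normalizes_anticommuting
      ((commute_mk_iff.mp (hN _ hI _ hJ)).resolve_left hIJ) hIJ hN hI hJ hn hAn hBn hA1 hB1
      (hnorm _ hAmem) (hnorm _ hBmem) hAB
    exact h2.elim (htr h1).1 (htr h1).2

theorem trace_inv_mul_mul (A g : SL(2, F)) :
    trace ((g⁻¹ * A * g : SL(2, F)) : Matrix (Fin 2) (Fin 2) F) =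
      trace (A : Matrix (Fin 2) (Fin 2) F) := by
  rw [coe_mul, coe_mul, trace_mul_cycle, ← coe_mul, mul_inv_cancel, coe_one, one_mul]

theorem _root_.Matrix.det_commutator (A B : Matrix (Fin 2) (Fin 2) F) :
    (A * B - B * A).det = 4 * A.det * B.det - A.trace ^ 2 * B.det - B.trace ^ 2 * A.det -
      (A * B).trace ^ 2 + A.trace * B.trace * (A * B).trace := by
  simp only [trace_fin_two, det_fin_two, sub_apply, mul_apply, Fin.sum_univ_two]
  ring

theorem exists_conj_det_trace (A : SL(2, F)) (hA : (A : PSL(2, F)) ≠ 1) (v : F) :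
    ∃ g : SL(2, F), (A * (g⁻¹ * A * g : SL(2, F)) - (g⁻¹ * A * g : SL(2, F)) * A :
        Matrix (Fin 2) (Fin 2) F).det =
          v ^ 2 * (trace (A : Matrix (Fin 2) (Fin 2) F) ^ 2 - 4 - v ^ 2) ∧
      trace (A * (g⁻¹ * A * g : SL(2, F)) : Matrix (Fin 2) (Fin 2) F) =
        trace (A : Matrix (Fin 2) (Fin 2) F) ^ 2 - 2 - v ^ 2 := by
  rw [ne_eq, mk_eq_one_iff, not_or] at hA
  have hns := not_scalar hA.1 hA.2
  have hd := A.det_coe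
  rw [det_fin_two] at hd
  obtain ⟨p, q, r, hpqr, h⟩ : ∃ p q r : F, p ^ 2 + q * r = 0 ∧
      p * (A 0 0 - A 1 1) + r * A 0 1 + q * A 1 0 = v := by
    by_cases h01 : A 0 1 = 0
    · by_cases h10 : A 1 0 = 0
      · have : A 0 0 - A 1 1 ≠ 0 := sub_ne_zero.mpr fun h => hns ⟨h01, h10, h⟩
        exact ⟨v / (A 0 0 - A 1 1), v / (A 0 0 - A 1 1), -(v / (A 0 0 - A 1 1)), by ring,
          by simp [h01, h10, this]⟩
      · exact ⟨0, v / A 1 0, 0, by ring, by simp [h10]⟩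
    · exact ⟨0, 0, v / A 0 1, by ring, by simp [h01]⟩
  let g : SL(2, F) := ⟨!![1 + p, q; r, 1 - p], by rw [det_fin_two_of]; linear_combination -hpqr⟩
  have htr : trace (A * (g⁻¹ * A * g : SL(2, F)) : Matrix (Fin 2) (Fin 2) F) =
      trace (A : Matrix (Fin 2) (Fin 2) F) ^ 2 - 2 - v ^ 2 := by
    have hB : ((g⁻¹ * A * g : SL(2, F)) : Matrix (Fin 2) (Fin 2) F) =
        !![1 - p, -q; -r, 1 + p] * A * !![1 + p, q; r, 1 - p] := by
      rw [coe_mul, coe_mul, coe_inv, coe_mk, adjugate_fin_two_of]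
    subst h
    rw [hB]
    simp only [trace_fin_two, mul_apply, Fin.sum_univ_two, of_apply, cons_val', cons_val_zero,
      cons_val_one, cons_val_fin_one]
    grind
  refine ⟨g, ?_, htr⟩
  have hgtr : trace ((g⁻¹ * A * g : SL(2, F)) : Matrix (Fin 2) (Fin 2) F) =
      trace (A : Matrix (Fin 2) (Fin 2) F) := trace_inv_mul_mul A g
  rw [det_commutator, htr, hgtr, det_coe, det_coe]
  ring

end Matrix.SpecialLinearGroup

end TwoByTwo

theorem psl2_nonsolvable_pair
    (F : Type*) [Field F] [Fintype F] (hF : 4 ≤ Fintype.card F)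
    (x : Matrix.ProjectiveSpecialLinearGroup (Fin 2) F) (p : ℕ)
    (hp : p.Prime) (hodd : Odd p) (hx : orderOf x = p) :
    ∃ g : Matrix.ProjectiveSpecialLinearGroup (Fin 2) F,
      ¬ IsSolvable ↥(Subgroup.closure
        ({x, g⁻¹ * x * g} : Set (Matrix.ProjectiveSpecialLinearGroup (Fin 2) F))) := by
  induction x using QuotientGroup.induction_on with | _ A
  have hA1 : (A : PSL(2, F)) ≠ 1 := fun h => hp.one_lt.ne' (by rw [← hx, h, orderOf_one])
  have hAp : (A : PSL(2, F)) ^ p = 1 := hx ▸ pow_orderOf_eq_one _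
  obtain ⟨v, hv0, hv1, hv2⟩ := exists_sq_avoiding hF (trace (A : Matrix (Fin 2) (Fin 2) F))
  obtain ⟨g, hdet, htr⟩ := A.exists_conj_det_trace hA1 v
  refine ⟨g, SpecialLinearGroup.not_isSolvable_closure_pair (B := g⁻¹ * A * g) hodd hAp ?_ ?_ ?_⟩
  · have := conj_pow (a := (g : PSL(2, F))⁻¹) (b := (A : PSL(2, F))) (i := p)
    rw [inv_inv, hAp, mul_one, inv_mul_cancel] at this
    exact this
  · rw [hdet]
    exact mul_ne_zero (pow_ne_zero _ hv0) fun h => hv1 (by linear_combination -h)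
  · intro ht
    rw [htr, SpecialLinearGroup.trace_inv_mul_mul]
    exact ⟨fun h => (hv2 ht).1 (by linear_combination ht - h),
      fun h => (hv2 ht).2 (by linear_combination -h)⟩
end

section
/- Let p be a prime with p ≥ 5 and let x ∈ PSL(2, 𝔽_p) have order p. Then there exists g ∈ PSL(2, 𝔽_p) such that the subgroup generated by x and g⁻¹xg is all of PSL(2, 𝔽_p). -/
open Matrix Matrix.SpecialLinearGroup in
/-- A matrix in `SL(2, F)` of trace `2` is conjugate in `SL(2, F)` to an upper transvection. -/
theorem exists_conj_transvection_of_trace_eq_two {F : Type*} [Field F]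
    (Y : SpecialLinearGroup (Fin 2) F) (hY : (Y : Matrix (Fin 2) (Fin 2) F).trace = 2) :
    ∃ (P : SpecialLinearGroup (Fin 2) F) (t : F),
      Y = P * SpecialLinearGroup.transvection (zero_ne_one (α := Fin 2)) t * P⁻¹ := by
  obtain ⟨a, b, c, d, hM⟩ : ∃ a b c d, (Y : Matrix (Fin 2) (Fin 2) F) = !![a, b; c, d] :=
    ⟨_, _, _, _, eta_fin_two _⟩
  have hdet : a * d - b * c = 1 := by rw [← det_fin_two_of, ← hM, Y.det_coe]
  have htr : a + d = 2 := by simpa [hM, trace_fin_two] using hY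
  obtain rfl : d = 2 - a := by linear_combination htr
  by_cases hc : c = 0
  · have ha : a = 1 := by
      have : (a - 1) ^ 2 = 0 := by linear_combination -hdet - b * hc
      linear_combination pow_eq_zero_iff two_ne_zero |>.1 this
    refine ⟨1, b, Subtype.ext ?_⟩
    subst hc ha
    rw [one_mul, inv_one, mul_one, hM, transvection_coe]
    ext i j
    fin_cases i <;> fin_cases j <;> norm_num
  · obtain ⟨P, hP⟩ : ∃ P : SpecialLinearGroup (Fin 2) F,
        (P : Matrix (Fin 2) (Fin 2) F) = !![a - 1, -c⁻¹; c, 0] :=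
      ⟨⟨_, by simp [det_fin_two_of, hc]⟩, rfl⟩
    refine ⟨P, -c⁻¹, ?_⟩
    rw [eq_mul_inv_iff_mul_eq]
    refine Subtype.ext ?_
    rw [coe_mul, coe_mul, hM, hP, transvection_coe]
    ext i j
    fin_cases i <;> fin_cases j <;>
      simp [Matrix.mul_apply, Fin.sum_univ_two] <;> field_simp <;>
      first | ring1 | linear_combination -hdet

open Matrix Matrix.SpecialLinearGroup in
/-- Every transvection over `ZMod p` is a power of any nontrivial one in the same root subgroup. -/
theorem transvection_mem_of_transvection_mem {p : ℕ} [Fact p.Prime] {ι : Type*} [DecidableEq ι]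
    [Fintype ι] {i j : ι} (hij : i ≠ j) {t : ZMod p} (ht : t ≠ 0)
    {H : Subgroup (SpecialLinearGroup ι (ZMod p))}
    (h : SpecialLinearGroup.transvection hij t ∈ H) (c : ZMod p) :
    SpecialLinearGroup.transvection hij c ∈ H := by
  have key : ∀ n : ℕ, SpecialLinearGroup.transvection hij (n * t) ∈ H := by
    intro n
    induction n with
    | zero => simp [H.one_mem]
    | succ n ih =>
      rw [Nat.cast_succ, add_mul, one_mul, transvection_add]
      exact H.mul_mem ih h
  have := key (c / t).val
  rwa [ZMod.natCast_zmod_val, div_mul_cancel₀ _ ht] at this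

open Matrix Matrix.SpecialLinearGroup in
/-- A nontrivial upper transvection over `ZMod p` and a suitable conjugate of it
generate `SL(2, ZMod p)`. -/
theorem exists_closure_transvection_conj_eq_top {p : ℕ} [Fact p.Prime] {t : ZMod p} (ht : t ≠ 0) :
    ∃ w : SpecialLinearGroup (Fin 2) (ZMod p),
      Subgroup.closure {SpecialLinearGroup.transvection (zero_ne_one (α := Fin 2)) t,
        w⁻¹ * SpecialLinearGroup.transvection (zero_ne_one (α := Fin 2)) t * w} = ⊤ := by
  obtain ⟨w, hw₀⟩ : ∃ w : SpecialLinearGroup (Fin 2) (ZMod p),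
      (w : Matrix (Fin 2) (Fin 2) (ZMod p)) = !![0, -1; 1, 0] :=
    ⟨⟨_, by simp [det_fin_two_of]⟩, rfl⟩
  have hw : w⁻¹ * SpecialLinearGroup.transvection (zero_ne_one (α := Fin 2)) t * w =
      SpecialLinearGroup.transvection (one_ne_zero (α := Fin 2)) (-t) := by
    rw [mul_assoc, inv_mul_eq_iff_eq_mul]
    refine Subtype.ext ?_
    rw [coe_mul, coe_mul, hw₀, transvection_coe, transvection_coe]
    ext i j
    fin_cases i <;> fin_cases j <;> simp [Matrix.mul_apply, Fin.sum_univ_two]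
  refine ⟨w, ?_⟩
  rw [hw, Subgroup.eq_top_iff']
  refine SL2.transvection_induction _ (fun i j hij c ↦ ?_) fun A B ↦ Subgroup.mul_mem _
  have h01 := Subgroup.subset_closure (Set.mem_insert
    (SpecialLinearGroup.transvection (zero_ne_one (α := Fin 2)) t)
    {SpecialLinearGroup.transvection (one_ne_zero (α := Fin 2)) (-t)})
  have h10 := Subgroup.subset_closure (Set.mem_insert_of_mem
    (SpecialLinearGroup.transvection (zero_ne_one (α := Fin 2)) t)
    (Set.mem_singleton (SpecialLinearGroup.transvection (one_ne_zero (α := Fin 2)) (-t))))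
  fin_cases i <;> fin_cases j
  · exact absurd rfl hij
  · exact transvection_mem_of_transvection_mem _ ht h01 c
  · exact transvection_mem_of_transvection_mem _ (neg_ne_zero.2 ht) h10 c
  · exact absurd rfl hij

open Matrix Matrix.SpecialLinearGroup in
/-- An element of `PSL(2, ZMod p)` killed by `p` lifts to an element of `SL(2, ZMod p)`
of trace `2`. -/
theorem exists_lift_trace_eq_two {p : ℕ} [Fact p.Prime]
    (x : ProjectiveSpecialLinearGroup (Fin 2) (ZMod p)) (hx : x ^ p = 1) :
    ∃ Y : SpecialLinearGroup (Fin 2) (ZMod p),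
      (Y : ProjectiveSpecialLinearGroup (Fin 2) (ZMod p)) = x ∧
        (Y : Matrix (Fin 2) (Fin 2) (ZMod p)).trace = 2 := by
  obtain ⟨X, rfl⟩ := QuotientGroup.mk_surjective x
  rw [← QuotientGroup.mk_pow, QuotientGroup.eq_one_iff, mem_center_iff] at hx
  obtain ⟨r, hr, hrX⟩ := hx
  have htr : (X : Matrix (Fin 2) (Fin 2) (ZMod p)).trace = 2 * r := by
    have h := ZMod.trace_pow_card (X : Matrix (Fin 2) (Fin 2) (ZMod p))
    rw [ZMod.pow_card, ← coe_pow, ← hrX] at h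
    rw [← h]
    simp [two_mul]
  rcases sq_eq_one_iff.1 hr with rfl | rfl
  · exact ⟨X, rfl, by simpa using htr⟩
  · refine ⟨-X, ?_, by simp [htr]⟩
    rw [QuotientGroup.eq, mem_center_iff]
    refine ⟨-1, by simp, ?_⟩
    rw [inv_neg, neg_mul, inv_mul_cancel, map_neg, map_one, coe_neg, coe_one]

open Matrix Matrix.SpecialLinearGroup in
theorem psl2_p_generation
    (p : ℕ) (hp : p.Prime) (hp5 : 5 ≤ p)
    (x : Matrix.ProjectiveSpecialLinearGroup (Fin 2) (ZMod p))
    (hx : orderOf x = p) :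
    ∃ g : Matrix.ProjectiveSpecialLinearGroup (Fin 2) (ZMod p),
      Subgroup.closure
        ({x, g⁻¹ * x * g} : Set (Matrix.ProjectiveSpecialLinearGroup (Fin 2) (ZMod p))) = ⊤ := by
  have : Fact p.Prime := ⟨hp⟩
  obtain ⟨Y, rfl, hY⟩ := exists_lift_trace_eq_two x (orderOf_dvd_iff_pow_eq_one.1 hx.dvd)
  obtain ⟨P, t, rfl⟩ := exists_conj_transvection_of_trace_eq_two Y hY
  have ht : t ≠ 0 := by
    rintro rfl
    simp only [transvection_coeff_zero, mul_one, mul_inv_cancel, QuotientGroup.mk_one,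
      orderOf_one] at hx
    omega
  obtain ⟨w, hw⟩ := exists_closure_transvection_conj_eq_top ht
  let f := (QuotientGroup.mk' (Subgroup.center (SpecialLinearGroup (Fin 2) (ZMod p)))).comp
    (MulAut.conj P).toMonoidHom
  have hf : Function.Surjective f :=
    (QuotientGroup.mk'_surjective _).comp (MulAut.conj P).surjective
  refine ⟨f w, ?_⟩
  change Subgroup.closure {f (SpecialLinearGroup.transvection _ t),
    (f w)⁻¹ * f (SpecialLinearGroup.transvection _ t) * f w} = ⊤
  rw [← map_inv, ← map_mul, ← map_mul, ← Set.image_pair, ← MonoidHom.map_closure, hw,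
    Subgroup.map_top_of_surjective f hf]
end

section
/- Let F be a finite field with q elements and let x ∈ PSL(2, F) have odd prime order p with p dividing q − 1. Then there exists g ∈ PSL(2, F) such that the commutator ⁅x, g⁆ = x⁻¹g⁻¹xg has order (q + 1)/gcd(2, q − 1); in particular ⟨x, g⁻¹xg⟩ contains a generator of a nonsplit (irreducible) torus. -/
open Matrix

theorem mem_center_sl2_iff {F : Type*} [Field F] (A : Matrix.SpecialLinearGroup (Fin 2) F) :
    A ∈ Subgroup.center (Matrix.SpecialLinearGroup (Fin 2) F) ↔
      A 0 1 = 0 ∧ A 1 0 = 0 ∧ A 0 0 = A 1 1 := by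
  rw [Matrix.SpecialLinearGroup.mem_center_iff]
  constructor
  · rintro ⟨r, -, h⟩
    simp [← h]
  · rintro ⟨h₁, h₂, h₃⟩
    have hd := A.det_coe
    rw [det_fin_two, h₁, h₃] at hd
    refine ⟨A 1 1, by simpa [sq] using hd, ?_⟩
    ext i j
    fin_cases i <;> fin_cases j <;> simp [h₁, h₂, h₃]

theorem exists_pow_eq_smul_add_smul {F K : Type*} [Field F] [Field K] [Algebra F K]
    (M : Matrix (Fin 2) (Fin 2) F) (ζ : K)
    (h : ζ ^ 2 = algebraMap F K M.trace * ζ - algebraMap F K M.det) (n : ℕ) :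
    ∃ α β : F, M ^ n = α • M + β • 1 ∧ ζ ^ n = algebraMap F K α * ζ + algebraMap F K β := by
  have hM : M * M = M.trace • M - M.det • 1 := by
    ext i j
    fin_cases i <;> fin_cases j <;>
      simp [mul_apply, Fin.sum_univ_two, trace_fin_two, det_fin_two] <;> ring
  induction n with
  | zero => exact ⟨0, 1, by simp, by simp⟩
  | succ n ih =>
    obtain ⟨α, β, h₁, h₂⟩ := ih
    refine ⟨α * M.trace + β, -α * M.det, ?_, ?_⟩
    · rw [pow_succ, h₁, add_mul, smul_mul_assoc, hM]
      simp only [smul_mul_assoc, one_mul]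
      module
    · rw [pow_succ, h₂]
      simp only [map_add, map_mul, map_neg]
      linear_combination (algebraMap F K α) * h

/-- If `ζ ∉ F` is an eigenvalue of `A`, then a power of `A` is central exactly when the same power
of `ζ` lies in `F`. -/
theorem pow_mem_center_iff {F K : Type*} [Field F] [Field K] [Algebra F K]
    (A : Matrix.SpecialLinearGroup (Fin 2) F)
    (hA : A ∉ Subgroup.center (Matrix.SpecialLinearGroup (Fin 2) F))
    (ζ : K) (hζ : ζ ∉ (algebraMap F K).range)
    (h : ζ ^ 2 = algebraMap F K (A : Matrix (Fin 2) (Fin 2) F).trace * ζ - 1)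
    (n : ℕ) :
    A ^ n ∈ Subgroup.center (Matrix.SpecialLinearGroup (Fin 2) F) ↔
      ζ ^ n ∈ (algebraMap F K).range := by
  obtain ⟨α, β, h₁, h₂⟩ := exists_pow_eq_smul_add_smul (A : Matrix (Fin 2) (Fin 2) F) ζ
    (by simpa using h) n
  have key₁ : A ^ n ∈ Subgroup.center (Matrix.SpecialLinearGroup (Fin 2) F) ↔ α = 0 := by
    rw [mem_center_sl2_iff] at hA ⊢
    rw [Matrix.SpecialLinearGroup.coe_pow, h₁]
    simp
    grind
  have key₂ : ζ ^ n ∈ (algebraMap F K).range ↔ α = 0 := by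
    constructor
    · rintro ⟨y, hy⟩
      by_contra hα
      have hα' : algebraMap F K α ≠ 0 := by simpa using hα
      refine hζ ⟨(y - β) / α, ?_⟩
      rw [map_div₀, map_sub, hy, h₂]
      field_simp
      ring
    · rintro rfl
      exact ⟨β, by simp [h₂]⟩
  rw [key₁, key₂]

theorem mem_range_algebraMap_iff_pow_card {F K : Type*} [Field F] [Fintype F] [Field K]
    [Algebra F K] (x : K) :
    x ∈ (algebraMap F K).range ↔ x ^ Fintype.card F = x := by
  constructor
  · rintro ⟨y, rfl⟩
    rw [← map_pow, FiniteField.pow_card]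
  · intro h
    refine (Polynomial.splits_X_pow_nat_card_sub_X (K := F)).mem_range_of_isRoot ?_ ?_
    · exact FiniteField.X_pow_card_sub_X_ne_zero F (by simpa using Fintype.one_lt_card)
    · simp [h]

theorem eq_one_of_pow_eq_one_of_trace_eq_two {F : Type*} [Field F]
    (A : Matrix.SpecialLinearGroup (Fin 2) F) (n : ℕ) (hn : (n : F) ≠ 0) (hA : A ^ n = 1)
    (ht : (A : Matrix (Fin 2) (Fin 2) F).trace = 2) : A = 1 := by
  have hd : (A : Matrix (Fin 2) (Fin 2) F).det = 1 := A.2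
  have h0 : ((A : Matrix (Fin 2) (Fin 2) F) - 1) * (A - 1) = 0 := by
    rw [trace_fin_two] at ht
    rw [det_fin_two] at hd
    ext i j
    fin_cases i <;> fin_cases j <;> simp [mul_apply, Fin.sum_univ_two] <;> grind
  have hpow : ∀ m : ℕ, (A : Matrix (Fin 2) (Fin 2) F) ^ m =
      1 + (m : F) • ((A : Matrix _ _ F) - 1) := by
    intro m
    induction m with
    | zero => simp
    | succ m ih =>
      calc (A : Matrix (Fin 2) (Fin 2) F) ^ (m + 1)
          = (1 + (m : F) • ((A : Matrix _ _ F) - 1)) * (1 + ((A : Matrix _ _ F) - 1)) := by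
            rw [pow_succ, ih]; simp
        _ = 1 + ((m + 1 : ℕ) : F) • ((A : Matrix _ _ F) - 1) := by
            rw [add_mul, one_mul, mul_add, mul_one, smul_mul_assoc, h0]
            push_cast
            module
  have h1 := hpow n
  rw [← Matrix.SpecialLinearGroup.coe_pow, hA] at h1
  simp [hn, sub_eq_zero] at h1
  exact Subtype.ext (by simpa using h1)

theorem exists_trace_eq_add_inv {F : Type*} [Field F] [Fintype F]
    (A : Matrix.SpecialLinearGroup (Fin 2) F) {p : ℕ} (hodd : Odd p)
    (hdvd : p ∣ Fintype.card F - 1) (hA : A ^ p = 1)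
    (hc : A ∉ Subgroup.center (Matrix.SpecialLinearGroup (Fin 2) F)) :
    ∃ a : F, a ≠ 0 ∧ (A : Matrix (Fin 2) (Fin 2) F).trace = a + a⁻¹ ∧ a ^ 2 ≠ 1 := by
  set t := (A : Matrix (Fin 2) (Fin 2) F).trace with ht
  let K := AlgebraicClosure F
  obtain ⟨μ, hμ⟩ := IsAlgClosed.exists_aeval_eq_zero K
    (A : Matrix (Fin 2) (Fin 2) F).charpoly (by simp [charpoly_degree_eq_dim])
  simp only [charpoly_fin_two, map_add, map_sub, map_mul, map_pow, Polynomial.aeval_X,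
    Polynomial.aeval_C, Matrix.SpecialLinearGroup.det_coe, map_one] at hμ
  obtain ⟨α, β, h₁, h₂⟩ := exists_pow_eq_smul_add_smul (A : Matrix (Fin 2) (Fin 2) F) μ
    (by rw [Matrix.SpecialLinearGroup.det_coe, map_one]; linear_combination hμ) p
  have hμp : μ ^ p = 1 := by
    rw [← Matrix.SpecialLinearGroup.coe_pow, hA] at h₁
    rw [mem_center_sl2_iff] at hc
    have e00 := congrFun₂ h₁ 0 0
    have e01 := congrFun₂ h₁ 0 1
    have e10 := congrFun₂ h₁ 1 0
    have e11 := congrFun₂ h₁ 1 1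
    simp at e00 e01 e10 e11
    have hα : α = 0 := by grind
    have hβ : β = 1 := by grind
    simp [h₂, hα, hβ]
  have hq : 1 ≤ Fintype.card F := Fintype.card_pos
  obtain ⟨k, hk⟩ := hdvd
  have hμq : μ ∈ (algebraMap F K).range := by
    rw [mem_range_algebraMap_iff_pow_card, ← Nat.sub_add_cancel hq, pow_succ, hk, pow_mul, hμp]
    simp
  obtain ⟨a, rfl⟩ := hμq
  have inj := (algebraMap F K).injective
  have ha : a ^ 2 - t * a + 1 = 0 := inj (by simpa using hμ)
  have hap : a ^ p = 1 := inj (by simpa using hμp)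
  have ha0 : a ≠ 0 := by rintro rfl; simp at ha
  refine ⟨a, ha0, by field_simp; linear_combination -ha, fun ha2 ↦ hc ?_⟩
  obtain ⟨m, hm⟩ := hodd
  have ha1 : a = 1 := by rw [← hap, hm, pow_succ, pow_mul, ha2, one_pow, one_mul]
  have hp0 : (p : F) ≠ 0 := by
    intro h0
    have h1 : (Fintype.card F : F) = p * k + 1 := by
      rw [← Nat.sub_add_cancel hq, hk]; push_cast; ring
    simp [h0] at h1
  rw [ha1] at ha
  rw [eq_one_of_pow_eq_one_of_trace_eq_two A p hp0 hA (by rw [← ht]; linear_combination -ha)]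
  exact one_mem _

theorem exists_eq_conj_diagonal {F : Type*} [Field F]
    (A : Matrix.SpecialLinearGroup (Fin 2) F) {a : F} (ha : a ≠ 0)
    (ht : (A : Matrix (Fin 2) (Fin 2) F).trace = a + a⁻¹) (ha2 : a ^ 2 ≠ 1) :
    ∃ P D : Matrix.SpecialLinearGroup (Fin 2) F,
      A = P * D * P⁻¹ ∧ (D : Matrix (Fin 2) (Fin 2) F) = !![a, 0; 0, a⁻¹] := by
  have hd : (A : Matrix (Fin 2) (Fin 2) F).det = 1 := A.2
  have key : ∀ b : F, b ^ 2 - (a + a⁻¹) * b + 1 = 0 →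
      ∃ v : Fin 2 → F, v ≠ 0 ∧ A 0 0 * v 0 + A 0 1 * v 1 = b * v 0 ∧
        A 1 0 * v 0 + A 1 1 * v 1 = b * v 1 := by
    intro b hb
    obtain ⟨v, hv, h⟩ := exists_mulVec_eq_zero_iff.mpr
      (show ((A : Matrix (Fin 2) (Fin 2) F) - b • 1).det = 0 by
        rw [trace_fin_two] at ht
        rw [det_fin_two] at hd
        simp [det_fin_two]
        linear_combination hd + hb - b * ht)
    have h0 := congrFun h 0
    have h1 := congrFun h 1
    simp [mulVec, dotProduct, Fin.sum_univ_two] at h0 h1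
    exact ⟨v, hv, by linear_combination h0, by linear_combination h1⟩
  obtain ⟨v, hv, hv0, hv1⟩ := key a (by field_simp; ring)
  obtain ⟨w, hw, hw0, hw1⟩ := key a⁻¹ (by field_simp; ring)
  have hab : a - a⁻¹ ≠ 0 := by
    intro h
    apply ha2
    field_simp at h
    linear_combination h
  have hvw : v 0 * w 1 - v 1 * w 0 ≠ 0 := by
    intro h
    have e0 : (a - a⁻¹) * (v 0 * w 0) = 0 := by
      linear_combination -w 0 * hv0 + v 0 * hw0 - A 0 1 * h
    have e1 : (a - a⁻¹) * (v 1 * w 1) = 0 := by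
      linear_combination -w 1 * hv1 + v 1 * hw1 + A 1 0 * h
    have e2 : (a - a⁻¹) * (v 1 * w 0) = 0 := by
      linear_combination -w 0 * hv1 + v 0 * hw1 - A 1 1 * h + a⁻¹ * h
    have hv' : v 0 ≠ 0 ∨ v 1 ≠ 0 := by
      by_contra! hh
      exact hv (funext fun i ↦ by fin_cases i <;> simp [hh])
    have hw' : w 0 ≠ 0 ∨ w 1 ≠ 0 := by
      by_contra! hh
      exact hw (funext fun i ↦ by fin_cases i <;> simp [hh])
    grind
  set d := v 0 * w 1 - v 1 * w 0 with hdd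
  obtain ⟨P, hP⟩ : ∃ P : Matrix.SpecialLinearGroup (Fin 2) F,
      (P : Matrix (Fin 2) (Fin 2) F) = !![v 0, w 0 / d; v 1, w 1 / d] :=
    ⟨⟨_, by rw [det_fin_two_of]; field_simp; rw [hdd]; ring⟩, rfl⟩
  obtain ⟨D, hD⟩ : ∃ D : Matrix.SpecialLinearGroup (Fin 2) F,
      (D : Matrix (Fin 2) (Fin 2) F) = !![a, 0; 0, a⁻¹] :=
    ⟨⟨_, by rw [det_fin_two_of]; field_simp; ring⟩, rfl⟩
  refine ⟨P, D, eq_mul_inv_of_mul_eq ?_, hD⟩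
  ext i j
  fin_cases i <;> fin_cases j <;>
    simp [hP, hD, mul_apply, Fin.sum_univ_two]
  · linear_combination hv0
  · linear_combination hw0 / d
  · linear_combination hv1
  · linear_combination hw1 / d

/-- Every element of `F` is the trace of a commutator of `A` when `A` has distinct eigenvalues
in `F`. -/
theorem exists_trace_commutator_eq {F : Type*} [Field F]
    (A : Matrix.SpecialLinearGroup (Fin 2) F) {a : F} (ha : a ≠ 0)
    (ht : (A : Matrix (Fin 2) (Fin 2) F).trace = a + a⁻¹) (ha2 : a ^ 2 ≠ 1) (τ : F) :
    ∃ G : Matrix.SpecialLinearGroup (Fin 2) F,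
      ((A⁻¹ * G⁻¹ * A * G : Matrix.SpecialLinearGroup (Fin 2) F) :
        Matrix (Fin 2) (Fin 2) F).trace = τ := by
  obtain ⟨P, D, rfl, hD⟩ := exists_eq_conj_diagonal A ha ht ha2
  have hab : a - a⁻¹ ≠ 0 := by
    intro h
    apply ha2
    field_simp at h
    linear_combination h
  obtain ⟨s, hs⟩ : ∃ s : F, s * (a - a⁻¹) ^ 2 = 2 - τ :=
    ⟨(2 - τ) / (a - a⁻¹) ^ 2, div_mul_cancel₀ _ (pow_ne_zero 2 hab)⟩
  obtain ⟨G, hG⟩ : ∃ G : Matrix.SpecialLinearGroup (Fin 2) F,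
      (G : Matrix (Fin 2) (Fin 2) F) = !![1, s; 1, 1 + s] :=
    ⟨⟨_, by rw [det_fin_two_of]; ring⟩, rfl⟩
  refine ⟨P * G * P⁻¹, ?_⟩
  have hconj : (P * D * P⁻¹)⁻¹ * (P * G * P⁻¹)⁻¹ * (P * D * P⁻¹) * (P * G * P⁻¹) =
      P * (D⁻¹ * G⁻¹ * D * G) * P⁻¹ := by group
  rw [hconj, Matrix.SpecialLinearGroup.coe_mul, trace_mul_comm, ← Matrix.SpecialLinearGroup.coe_mul,
    inv_mul_cancel_left]
  simp only [Matrix.SpecialLinearGroup.coe_mul, Matrix.SpecialLinearGroup.coe_inv, hD, hG,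
    adjugate_fin_two_of, mul_fin_two, trace_fin_two_of]
  have := mul_inv_cancel₀ ha
  linear_combination -hs + 2 * this

theorem orderOf_mk_eq_card_add_one_div {F K : Type*} [Field F] [Fintype F] [Field K] [Algebra F K]
    (A : Matrix.SpecialLinearGroup (Fin 2) F) (ζ : K)
    (hζ : IsPrimitiveRoot ζ (Fintype.card F + 1))
    (ht : algebraMap F K (A : Matrix (Fin 2) (Fin 2) F).trace = ζ + ζ⁻¹) :
    orderOf (QuotientGroup.mk A : Matrix.ProjectiveSpecialLinearGroup (Fin 2) F) =
      (Fintype.card F + 1) / Nat.gcd 2 (Fintype.card F - 1) := by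
  have hq : 1 < Fintype.card F := Fintype.one_lt_card
  obtain ⟨m, hm⟩ : ∃ m, Fintype.card F = m + 1 := ⟨Fintype.card F - 1, by omega⟩
  have hζ0 : ζ ≠ 0 := hζ.ne_zero (by omega)
  have hg : Nat.gcd 2 (Fintype.card F - 1) = Nat.gcd (Fintype.card F + 1) m := by
    rw [hm, Nat.add_sub_cancel, show m + 1 + 1 = 2 + m by ring, Nat.gcd_add_self_left]
  have hrange : ∀ n, ζ ^ n ∈ (algebraMap F K).range ↔
      (Fintype.card F + 1) / Nat.gcd 2 (Fintype.card F - 1) ∣ n := by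
    intro n
    have hg0 : 0 < Nat.gcd (Fintype.card F + 1) m :=
      Nat.gcd_pos_of_pos_left _ (Nat.succ_pos _)
    have hdvd : Fintype.card F + 1 ∣ n * m ↔
        (Fintype.card F + 1) / Nat.gcd (Fintype.card F + 1) m ∣ n := by
      rw [iff_comm, ← (Nat.coprime_div_gcd_div_gcd hg0).dvd_mul_right,
        ← Nat.mul_dvd_mul_iff_right hg0, mul_assoc, Nat.div_mul_cancel (Nat.gcd_dvd_left _ _),
        Nat.div_mul_cancel (Nat.gcd_dvd_right _ _)]
    have hpow : (ζ ^ n) ^ Fintype.card F = ζ ^ n ↔ ζ ^ (n * m) = 1 := by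
      rw [hm, pow_succ, ← pow_mul, mul_eq_right₀ (pow_ne_zero n hζ0)]
    rw [mem_range_algebraMap_iff_pow_card, hpow, hζ.pow_eq_one_iff_dvd, hg, hdvd]
  have hζF : ζ ∉ (algebraMap F K).range := by
    intro h
    rw [← pow_one ζ, hrange, Nat.dvd_one] at h
    have hle : Nat.gcd 2 (Fintype.card F - 1) ≤ 2 := Nat.gcd_le_left _ two_pos
    have hdvd : Nat.gcd 2 (Fintype.card F - 1) ∣ Fintype.card F + 1 := by
      rw [hg]; exact Nat.gcd_dvd_left _ _
    have := Nat.eq_mul_of_div_eq_right hdvd h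
    omega
  have hζ2 : ζ ^ 2 = algebraMap F K (A : Matrix (Fin 2) (Fin 2) F).trace * ζ - 1 := by
    rw [ht]; field_simp; ring
  have hA : A ∉ Subgroup.center (Matrix.SpecialLinearGroup (Fin 2) F) := by
    rw [mem_center_sl2_iff]
    rintro ⟨h₁, h₂, h₃⟩
    have hd : (A : Matrix (Fin 2) (Fin 2) F).det = 1 := A.2
    rw [det_fin_two, h₁, h₃, zero_mul, sub_zero] at hd
    have hd' := congrArg (algebraMap F K) hd
    rw [trace_fin_two, h₃] at hζ2
    simp only [map_mul, map_add, map_one] at hd' hζ2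
    refine hζF ⟨A 1 1, ?_⟩
    have : (algebraMap F K (A 1 1) - ζ) ^ 2 = 0 := by linear_combination hd' + hζ2
    simpa [sub_eq_zero] using this
  have hpow : ∀ n, (QuotientGroup.mk A : Matrix.ProjectiveSpecialLinearGroup (Fin 2) F) ^ n = 1 ↔
      (Fintype.card F + 1) / Nat.gcd 2 (Fintype.card F - 1) ∣ n := by
    intro n
    rw [← hrange, ← pow_mem_center_iff A hA ζ hζF hζ2 n, ← QuotientGroup.eq_one_iff]
    rfl
  exact Nat.dvd_antisymm (orderOf_dvd_of_pow_eq_one ((hpow _).2 dvd_rfl))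
    ((hpow _).1 (pow_orderOf_eq_one _))

theorem psl2_split_commutator_order
    (F : Type*) [Field F] [Fintype F]
    (x : Matrix.ProjectiveSpecialLinearGroup (Fin 2) F) (p : ℕ)
    (hp : p.Prime) (hodd : Odd p) (hx : orderOf x = p)
    (hdvd : p ∣ Fintype.card F - 1) :
    ∃ g : Matrix.ProjectiveSpecialLinearGroup (Fin 2) F,
      orderOf (x⁻¹ * g⁻¹ * x * g) =
        (Fintype.card F + 1) / Nat.gcd 2 (Fintype.card F - 1) := by
  obtain ⟨A, hAp, rfl⟩ : ∃ A : Matrix.SpecialLinearGroup (Fin 2) F,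
      A ^ p = 1 ∧ QuotientGroup.mk A = x := by
    obtain ⟨B, rfl⟩ := QuotientGroup.mk_surjective x
    have hxp : (QuotientGroup.mk (B ^ p) : Matrix.ProjectiveSpecialLinearGroup (Fin 2) F) = 1 := by
      have h := pow_orderOf_eq_one
        (QuotientGroup.mk B : Matrix.ProjectiveSpecialLinearGroup (Fin 2) F)
      rwa [hx] at h
    have hc := (QuotientGroup.eq_one_iff _).1 hxp
    obtain ⟨r, hr, hrB⟩ := Matrix.SpecialLinearGroup.mem_center_iff.1 hc
    have hB2 : (B ^ p) ^ 2 = 1 := by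
      apply Subtype.ext
      rw [Matrix.SpecialLinearGroup.coe_pow (B ^ p), ← hrB, ← map_pow, ← Fintype.card_fin 2, hr]
      simp
    refine ⟨B ^ (p + 1), ?_, ?_⟩
    · obtain ⟨k, hk⟩ := hodd
      rw [← pow_mul, mul_comm (p + 1) p, pow_mul, show p + 1 = 2 * (k + 1) by omega, pow_mul, hB2,
        one_pow]
    · rw [pow_succ, QuotientGroup.mk_mul, hxp, one_mul]
  have hA : A ∉ Subgroup.center (Matrix.SpecialLinearGroup (Fin 2) F) := by
    intro h
    rw [(QuotientGroup.eq_one_iff A).2 h, orderOf_one] at hx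
    exact hp.one_lt.ne hx
  obtain ⟨a, ha, ht, ha2⟩ := exists_trace_eq_add_inv A hodd hdvd hAp hA
  have : NeZero ((Fintype.card F + 1 : ℕ) : F) := ⟨by simp⟩
  obtain ⟨ζ, hζ⟩ := HasEnoughRootsOfUnity.exists_primitiveRoot (AlgebraicClosure F)
    (Fintype.card F + 1)
  obtain ⟨τ, hτ⟩ : ζ + ζ⁻¹ ∈ (algebraMap F (AlgebraicClosure F)).range := by
    have hζq : ζ ^ Fintype.card F = ζ⁻¹ := by
      exact eq_inv_of_mul_eq_one_left (by rw [← pow_succ, hζ.pow_eq_one])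
    rw [mem_range_algebraMap_iff_pow_card]
    change FiniteField.frobeniusAlgHom F (AlgebraicClosure F) (ζ + ζ⁻¹) = ζ + ζ⁻¹
    rw [map_add, map_inv₀, FiniteField.coe_frobeniusAlgHom]
    simp only [hζq, inv_inv, add_comm]
  obtain ⟨G, hG⟩ := exists_trace_commutator_eq A ha ht ha2 τ
  exact ⟨QuotientGroup.mk G, orderOf_mk_eq_card_add_one_div _ ζ hζ (by rw [hG, hτ])⟩
end

section
/- Let F be a finite field with q elements and let x ∈ PSL(2, F) have odd prime order p with p dividing q + 1. Then there exists g ∈ PSL(2, F) such that the commutator ⁅x, g⁆ = x⁻¹g⁻¹xg has order (q − 1)/gcd(2, q − 1); in particular ⟨x, g⁻¹xg⟩ contains a generator of a split maximal torus. -/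
open Polynomial Matrix in
/-- A `2 × 2` matrix over a finite field with `q` elements whose characteristic polynomial has a
root satisfies `A ^ q ^ 2 = A ^ q`. -/
theorem FiniteField.matrix_pow_card_sq_eq {F : Type*} [Field F] [Fintype F]
    (A : Matrix (Fin 2) (Fin 2) F) {r : F} (hr : r ^ 2 - A.trace * r + A.det = 0) :
    A ^ (Fintype.card F * Fintype.card F) = A ^ Fintype.card F := by
  have hchar : A.charpoly = (X - C r) * (X - C (A.trace - r)) := by
    have hdet : A.det = r * (A.trace - r) := by linear_combination hr
    rw [Matrix.charpoly_fin_two, hdet]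
    simp only [map_mul, map_sub]
    ring
  have hroot (a : F) : (X - C a : F[X]) ∣ X ^ Fintype.card F - X := by
    rw [dvd_iff_isRoot]
    simp [IsRoot, FiniteField.pow_card]
  have hdvd : A.charpoly ∣ (X ^ Fintype.card F - X : F[X]) ^ Fintype.card F := by
    rw [hchar]
    refine (mul_dvd_mul (hroot _) (hroot _)).trans ?_
    rw [← sq]
    exact pow_dvd_pow _ Fintype.one_lt_card
  have hfrob : (X ^ Fintype.card F - X : F[X]) ^ Fintype.card F =
      X ^ (Fintype.card F * Fintype.card F) - X ^ Fintype.card F := by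
    obtain ⟨n, hℓ, hn⟩ := FiniteField.card F (ringChar F)
    have : Fact (ringChar F).Prime := ⟨hℓ⟩
    rw [hn, sub_pow_char_pow, ← pow_mul]
  have h0 := aeval_eq_zero_of_dvd_aeval_eq_zero hdvd (Matrix.aeval_self_charpoly A)
  rw [hfrob] at h0
  simpa [sub_eq_zero] using h0

/-- A binary quadratic polynomial over a finite field whose leading form is nondegenerate in odd
characteristic has a zero. -/
theorem FiniteField.exists_binary_quadratic_eq_zero {F : Type*} [Field F] [Fintype F]
    (e f g h : F) (hD : ringChar F ≠ 2 → e ^ 2 - 4 * f ≠ 0) :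
    ∃ s w : F, s ^ 2 + e * s * w + f * w ^ 2 + g * w + h = 0 := by
  by_cases h2 : ringChar F = 2
  · obtain ⟨s, hs⟩ := FiniteField.isSquare_of_char_two h2 (-h)
    exact ⟨s, 0, by linear_combination -hs⟩
  · have h2' : (2 : F) ≠ 0 := Ring.two_ne_zero h2
    have h4 : (4 : F) ≠ 0 := by
      rw [show (4 : F) = 2 * 2 by norm_num]
      exact mul_ne_zero h2' h2'
    have hlead : (f - e ^ 2 / 4) ≠ 0 := by
      intro h0
      apply hD h2
      field_simp at h0
      linear_combination -h0
    obtain ⟨s, w, hsw⟩ := FiniteField.exists_root_sum_quadratic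
      (f := (Polynomial.X ^ 2 : Polynomial F))
      (g := Polynomial.C (f - e ^ 2 / 4) * Polynomial.X ^ 2 + Polynomial.C g * Polynomial.X
        + Polynomial.C h)
      (by simp) (Polynomial.degree_quadratic hlead)
      (FiniteField.odd_card_of_char_ne_two h2)
    simp only [Polynomial.eval_add, Polynomial.eval_mul, Polynomial.eval_pow, Polynomial.eval_X,
      Polynomial.eval_C] at hsw
    refine ⟨s - e * w / 2, w, ?_⟩
    field_simp at hsw ⊢
    linear_combination hsw

namespace Matrix

/-- An element of `PSL(2, F)` of odd prime order dividing `q + 1` lifts to a matrix without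
eigenvalues in `F`. -/
theorem charpoly_ne_zero_of_orderOf_dvd_card_add_one {F : Type*} [Field F] [Fintype F]
    (A : SpecialLinearGroup (Fin 2) F) {p : ℕ} (hp : p.Prime) (hodd : Odd p)
    (hA : orderOf (QuotientGroup.mk A : ProjectiveSpecialLinearGroup (Fin 2) F) = p)
    (hdvd : p ∣ Fintype.card F + 1) (r : F) :
    r ^ 2 - (A : Matrix (Fin 2) (Fin 2) F).trace * r + 1 ≠ 0 := by
  intro hr
  have hpow := FiniteField.matrix_pow_card_sq_eq (A : Matrix (Fin 2) (Fin 2) F) (r := r)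
    (by rw [A.det_coe]; exact hr)
  have hpow' : A ^ (Fintype.card F * Fintype.card F) = A ^ Fintype.card F := by
    apply Subtype.ext
    simpa using hpow
  have hq : 1 < Fintype.card F := Fintype.one_lt_card
  obtain ⟨q, hcard⟩ : ∃ q, Fintype.card F = q + 1 := ⟨Fintype.card F - 1, by omega⟩
  rw [hcard] at hpow' hdvd
  have hone : A ^ ((q + 1) * q) = 1 := by
    rw [mul_add, mul_one, pow_add] at hpow'
    exact mul_eq_right.mp hpow'
  have hdvd' : p ∣ (q + 1) * q := by
    rw [← hA]
    apply orderOf_dvd_of_pow_eq_one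
    rw [← QuotientGroup.mk_pow, hone, QuotientGroup.mk_one]
  rcases hp.dvd_mul.mp hdvd' with h | h
  · have := (Nat.dvd_add_right h).mp hdvd
    exact hp.one_lt.ne' (Nat.dvd_one.mp this)
  · have : p ∣ 2 := (Nat.dvd_add_right h).mp hdvd
    have hp2 := (Nat.prime_dvd_prime_iff_eq hp Nat.prime_two).mp this
    subst hp2
    exact absurd hodd (by decide)

/-- If `A ∈ SL(2, F)` has no eigenvalue in `F`, then the commutators `A⁻¹ * g⁻¹ * A * g` with
`g ∈ SL(2, F)` take every value in `F` as a trace. -/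
theorem exists_trace_commutator_eq {F : Type*} [Field F] [Fintype F]
    (A : SpecialLinearGroup (Fin 2) F)
    (hA : ∀ r : F, r ^ 2 - (A : Matrix (Fin 2) (Fin 2) F).trace * r + 1 ≠ 0) (τ : F) :
    ∃ g : SpecialLinearGroup (Fin 2) F,
      ((A⁻¹ * g⁻¹ * A * g : SpecialLinearGroup (Fin 2) F) : Matrix (Fin 2) (Fin 2) F).trace =
        τ := by
  obtain ⟨a, b, c, d, hM⟩ : ∃ a b c d : F, (A : Matrix (Fin 2) (Fin 2) F) = !![a, b; c, d] :=
    ⟨_, _, _, _, Matrix.eta_fin_two _⟩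
  have hdet : a * d - b * c = 1 := by
    have := A.det_coe
    rwa [hM, det_fin_two_of] at this
  rw [hM] at hA
  simp only [trace_fin_two_of] at hA
  have hc : c ≠ 0 := by
    rintro rfl
    exact hA a (by linear_combination -hdet)
  have hD : ringChar F ≠ 2 → (a + d) ^ 2 - 4 ≠ 0 := by
    intro h2 h
    have h2' : (2 : F) ≠ 0 := Ring.two_ne_zero h2
    apply hA ((a + d) / 2)
    field_simp
    linear_combination -h
  obtain ⟨s, w, hsw⟩ := FiniteField.exists_binary_quadratic_eq_zero (a - d) (-(b * c))
    (-(τ - 2)) (-(τ - 2)) (fun h2 h => hD h2 (by linear_combination h + 4 * hdet))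
  have hm : w + 1 ≠ 0 := by
    intro hw
    have hw' : w = -1 := by linear_combination hw
    subst hw'
    exact hA (d + s) (by linear_combination hsw - hdet)
  obtain ⟨α, β, hαβ⟩ := FiniteField.exists_binary_quadratic_eq_zero (a + d) 1 0 (-(w + 1)⁻¹)
    (fun h2 h => hD h2 (by linear_combination h))
  have hk : (α ^ 2 + (a + d) * α * β + β ^ 2) * (w + 1) = 1 := by
    field_simp at hαβ
    linear_combination hαβ
  let k : Matrix (Fin 2) (Fin 2) F := !![α + β * a, β * b; β * c, α + β * d]
  let u : Matrix (Fin 2) (Fin 2) F := !![w + 1, s / c; 0, 1]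
  have hkdet : k.det = α ^ 2 + (a + d) * α * β + β ^ 2 := by
    simp only [k, det_fin_two_of]
    linear_combination β ^ 2 * hdet
  have hudet : u.det = w + 1 := by simp [u, det_fin_two_of]
  obtain ⟨g, hg⟩ : ∃ g : SpecialLinearGroup (Fin 2) F, (g : Matrix (Fin 2) (Fin 2) F) = k * u :=
    ⟨⟨k * u, by rw [det_mul, hkdet, hudet, hk]⟩, rfl⟩
  refine ⟨g, ?_⟩
  have hcomm : k.adjugate * !![a, b; c, d] * k = k.det • !![a, b; c, d] := by
    have : Commute !![a, b; c, d] k := by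
      simp only [Commute, SemiconjBy, k, mul_fin_two]
      ext i j
      fin_cases i <;> fin_cases j <;> simp <;> ring
    rw [mul_assoc, this.eq, ← mul_assoc, adjugate_mul, smul_mul_assoc, one_mul]
  have hprod : ((A : Matrix (Fin 2) (Fin 2) F).adjugate * (k * u).adjugate * A * (k * u)) =
      k.det • (!![d, -b; -c, a] * u.adjugate * !![a, b; c, d] * u) := by
    rw [hM, adjugate_mul_distrib, adjugate_fin_two_of]
    calc _ = !![d, -b; -c, a] * u.adjugate * (k.adjugate * !![a, b; c, d] * k) * u := by
          simp only [mul_assoc]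
      _ = _ := by rw [hcomm, mul_smul_comm, smul_mul_assoc]
  simp only [SpecialLinearGroup.coe_mul, SpecialLinearGroup.coe_inv, hg]
  rw [hprod, trace_smul, hkdet]
  have htr : (!![d, -b; -c, a] * u.adjugate * !![a, b; c, d] * u).trace = τ * (w + 1) := by
    simp only [u, adjugate_fin_two_of, mul_fin_two, trace_fin_two_of]
    field_simp
    linear_combination c * hsw + 2 * c * (w + 1) * hdet
  rw [htr, smul_eq_mul]
  linear_combination τ * hk

/-- The order in `PSL(2, F)` of a matrix with distinct eigenvalues `z`, `z⁻¹`. -/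
theorem mk_pow_eq_one_iff_of_trace_eq {F : Type*} [Field F]
    (B : SpecialLinearGroup (Fin 2) F) (z : Fˣ) (hz : z ^ 2 ≠ 1)
    (hB : (B : Matrix (Fin 2) (Fin 2) F).trace = z + (z⁻¹ : Fˣ)) (n : ℕ) :
    (QuotientGroup.mk B : ProjectiveSpecialLinearGroup (Fin 2) F) ^ n = 1 ↔ z ^ (2 * n) = 1 := by
  have hchar : (B : Matrix (Fin 2) (Fin 2) F).charpoly =
      (Polynomial.X - Polynomial.C (z : F)) * (Polynomial.X - Polynomial.C ((z⁻¹ : Fˣ) : F)) := by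
    have h1 : (Polynomial.C (z : F)) * Polynomial.C ((z⁻¹ : Fˣ) : F) = 1 := by
      rw [← map_mul, Units.mul_inv, map_one]
    rw [charpoly_fin_two, hB, B.det_coe, map_add, map_one]
    linear_combination -h1
  have hne : (z : F) ≠ ((z⁻¹ : Fˣ) : F) := by
    intro h
    apply hz
    rw [sq, ← eq_inv_iff_mul_eq_one]
    exact Units.ext h
  have hiff : z ^ (2 * n) = 1 ↔ (z : F) ^ n = ((z⁻¹ : Fˣ) : F) ^ n := by
    rw [two_mul, pow_add, ← eq_inv_iff_mul_eq_one, ← inv_pow, Units.ext_iff, Units.val_pow_eq_pow_val,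
      Units.val_pow_eq_pow_val]
  rw [← QuotientGroup.mk_pow, QuotientGroup.eq_one_iff, SpecialLinearGroup.mem_center_iff, hiff]
  constructor
  · rintro ⟨r, -, hr⟩
    have key (y : F) (hy : (B : Matrix (Fin 2) (Fin 2) F).charpoly.eval y = 0) : y ^ n = r := by
      rw [eval_charpoly] at hy
      obtain ⟨v, hv0, hv⟩ := exists_mulVec_eq_zero_iff.mpr hy
      have hv' : (B : Matrix (Fin 2) (Fin 2) F) *ᵥ v = y • v := by
        rw [sub_mulVec, sub_eq_zero] at hv
        simpa using hv.symm
      have hpow (m : ℕ) : (B : Matrix (Fin 2) (Fin 2) F) ^ m *ᵥ v = y ^ m • v := by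
        induction m with
        | zero => simp
        | succ m ih => rw [pow_succ, ← mulVec_mulVec, hv', mulVec_smul, ih, smul_smul, pow_succ']
      have h := hpow n
      rw [← SpecialLinearGroup.coe_pow, ← hr] at h
      exact smul_left_injective F hv0 (by simpa using h.symm)
    rw [key z (by simp [hchar]), key _ (by rw [hchar]; simp)]
  · intro h
    have hdvd : (B : Matrix (Fin 2) (Fin 2) F).charpoly ∣
        Polynomial.X ^ n - Polynomial.C ((z : F) ^ n) := by
      rw [hchar]
      refine IsCoprime.mul_dvd (Polynomial.isCoprime_X_sub_C_of_isUnit_sub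
        (sub_ne_zero.mpr hne).isUnit) ?_ ?_
      · rw [Polynomial.dvd_iff_isRoot]
        simp
      · rw [Polynomial.dvd_iff_isRoot, Polynomial.IsRoot, Polynomial.eval_sub, Polynomial.eval_C, h]
        simp
    have h0 := Polynomial.aeval_eq_zero_of_dvd_aeval_eq_zero hdvd (aeval_self_charpoly _)
    rw [map_sub, Polynomial.aeval_C, map_pow, Polynomial.aeval_X, sub_eq_zero] at h0
    refine ⟨(z : F) ^ n, ?_, ?_⟩
    · rw [Fintype.card_fin, ← pow_mul, mul_comm, ← Units.val_pow_eq_pow_val, hiff.mpr h,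
        Units.val_one]
    · rw [SpecialLinearGroup.coe_pow, h0]
      rfl

end Matrix

theorem psl2_nonsplit_commutator_order
    (F : Type*) [Field F] [Fintype F]
    (x : Matrix.ProjectiveSpecialLinearGroup (Fin 2) F) (p : ℕ)
    (hp : p.Prime) (hodd : Odd p) (hx : orderOf x = p)
    (hdvd : p ∣ Fintype.card F + 1) :
    ∃ g : Matrix.ProjectiveSpecialLinearGroup (Fin 2) F,
      orderOf (x⁻¹ * g⁻¹ * x * g) =
        (Fintype.card F - 1) / Nat.gcd 2 (Fintype.card F - 1) := by
  obtain ⟨A, rfl⟩ := QuotientGroup.mk_surjective x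
  obtain ⟨z, hz⟩ := IsCyclic.exists_ofOrder_eq_natCard (α := Fˣ)
  have hcard : Nat.card Fˣ = Fintype.card F - 1 := by
    rw [Nat.card_units, Nat.card_eq_fintype_card]
  rw [hcard] at hz
  have hpos : 0 < Fintype.card F - 1 := Nat.sub_pos_of_lt Fintype.one_lt_card
  by_cases hz2 : z ^ 2 = 1
  · have h2 : Fintype.card F - 1 ∣ 2 := hz ▸ orderOf_dvd_of_pow_eq_one hz2
    refine ⟨1, ?_⟩
    rw [Nat.gcd_eq_right h2, Nat.div_self hpos]
    simp
  · obtain ⟨g, hg⟩ := Matrix.exists_trace_commutator_eq A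
      (Matrix.charpoly_ne_zero_of_orderOf_dvd_card_add_one A hp hodd hx hdvd)
      (z + (z⁻¹ : Fˣ))
    refine ⟨QuotientGroup.mk g, Nat.dvd_right_iff_eq.mp fun n => ?_⟩
    have hpow := Matrix.mk_pow_eq_one_iff_of_trace_eq _ z hz2 hg n
    rw [orderOf_dvd_iff_pow_eq_one]
    refine hpow.trans ?_
    rw [← orderOf_dvd_iff_pow_eq_one, hz]
    rw [Nat.div_dvd_iff_dvd_mul (Nat.gcd_dvd_right _ _) (Nat.gcd_pos_of_pos_left _ two_pos),
      ← Nat.gcd_mul_right, Nat.dvd_gcd_iff, and_iff_left (dvd_mul_right _ _)]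
end

section
/- Let a be an odd prime and let F be the field with 3^a elements. If x ∈ PSL(2, F) has order 3, then there exists g ∈ PSL(2, F) such that the subgroup generated by x and g⁻¹xg is all of PSL(2, F). -/
open Matrix

namespace Matrix.SpecialLinearGroup

section Elementary

variable {K : Type*} [Field K]

/-- The upper triangular unipotent matrix with off-diagonal entry `u`. -/
def upperUnipotent (u : K) : SpecialLinearGroup (Fin 2) K :=
  ⟨!![1, u; 0, 1], by simp⟩

/-- The lower triangular unipotent matrix with off-diagonal entry `u`. -/
def lowerUnipotent (u : K) : SpecialLinearGroup (Fin 2) K :=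
  ⟨!![1, 0; u, 1], by simp⟩

/-- The diagonal torus: `t` is sent to the diagonal matrix with entries `t` and `t⁻¹`. -/
def diagUnit : Kˣ →* SpecialLinearGroup (Fin 2) K where
  toFun t := ⟨!![(t : K), 0; 0, (t : K)⁻¹], by simp⟩
  map_one' := by ext i j; fin_cases i <;> fin_cases j <;> simp
  map_mul' s t := by
    refine Subtype.ext (Eq.trans ?_ (coe_mul _ _).symm)
    ext i j
    fin_cases i <;> fin_cases j <;> simp [mul_comm]

lemma coe_upperUnipotent (u : K) :
    (upperUnipotent u : Matrix (Fin 2) (Fin 2) K) = !![1, u; 0, 1] := rfl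

lemma coe_lowerUnipotent (u : K) :
    (lowerUnipotent u : Matrix (Fin 2) (Fin 2) K) = !![1, 0; u, 1] := rfl

lemma coe_diagUnit (t : Kˣ) :
    (diagUnit t : Matrix (Fin 2) (Fin 2) K) = !![(t : K), 0; 0, (t : K)⁻¹] := rfl

lemma fin_two_ext {A B : SpecialLinearGroup (Fin 2) K} (h₀₀ : A 0 0 = B 0 0)
    (h₀₁ : A 0 1 = B 0 1) (h₁₀ : A 1 0 = B 1 0) (h₁₁ : A 1 1 = B 1 1) : A = B := by
  ext i j
  fin_cases i <;> fin_cases j <;> assumption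

lemma det_fin_two_eq_one (A : SpecialLinearGroup (Fin 2) K) :
    A 0 0 * A 1 1 - A 0 1 * A 1 0 = 1 := by
  rw [← det_fin_two, A.det_coe]

lemma smul_fin_two (A : SpecialLinearGroup (Fin 2) K) (x y : K) :
    A • ![x, y] = ![A 0 0 * x + A 0 1 * y, A 1 0 * x + A 1 1 * y] := by
  change (A : Matrix (Fin 2) (Fin 2) K) *ᵥ ![x, y] = _
  ext i
  fin_cases i <;> simp [mulVec, dotProduct, Fin.sum_univ_two]

lemma diagUnit_smul (t : Kˣ) (x y : K) : diagUnit t • ![x, y] = ![t * x, (t : K)⁻¹ * y] := by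
  simp [smul_fin_two, coe_diagUnit]

lemma upperUnipotent_smul (u x y : K) : upperUnipotent u • ![x, y] = ![x + u * y, y] := by
  simp [smul_fin_two, coe_upperUnipotent]

/-- A matrix of determinant one fixing the first basis vector is upper unipotent. -/
lemma eq_upperUnipotent_of_smul_eq {A : SpecialLinearGroup (Fin 2) K}
    (h : A • ![(1 : K), 0] = ![1, 0]) : A = upperUnipotent (A 0 1) := by
  rw [smul_fin_two] at h
  have h₀ := congrFun h 0
  have h₁ := congrFun h 1
  have hdet := det_fin_two_eq_one A
  simp only [mul_one, mul_zero, add_zero, cons_val_zero, cons_val_one] at h₀ h₁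
  rw [h₀, h₁] at hdet
  refine fin_two_ext ?_ ?_ ?_ ?_ <;> simp [coe_upperUnipotent, h₀, h₁]
  linear_combination hdet

lemma upperUnipotent_zero : upperUnipotent (0 : K) = 1 := by
  refine fin_two_ext ?_ ?_ ?_ ?_ <;> simp [coe_upperUnipotent]

lemma upperUnipotent_inv (u : K) : (upperUnipotent u)⁻¹ = upperUnipotent (-u) := by
  rw [inv_eq_iff_mul_eq_one]
  refine fin_two_ext ?_ ?_ ?_ ?_ <;> simp [coe_upperUnipotent]

lemma isConj_lowerUnipotent_mul_sq (u : K) {t : K} (ht : t ≠ 0) :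
    IsConj (lowerUnipotent (u * (t * t))) (lowerUnipotent u) := by
  refine isConj_iff.mpr ⟨diagUnit (Units.mk0 t ht), ?_⟩
  rw [← map_inv]
  refine fin_two_ext ?_ ?_ ?_ ?_ <;> simp [coe_lowerUnipotent, coe_diagUnit, ht]
  field_simp

lemma isConj_lowerUnipotent_of_trace_eq_two {A : SpecialLinearGroup (Fin 2) K}
    (htr : A 0 0 + A 1 1 = 2) (hc : A 1 0 ≠ 0) : IsConj (lowerUnipotent (A 1 0)) A := by
  have hdet := det_fin_two_eq_one A
  refine isConj_iff.mpr ⟨upperUnipotent ((A 0 0 - 1) / A 1 0), ?_⟩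
  rw [upperUnipotent_inv]
  refine fin_two_ext ?_ ?_ ?_ ?_ <;> simp [coe_lowerUnipotent, coe_upperUnipotent, hc]
  · field_simp
    linear_combination hdet - A 0 0 * htr
  · field_simp
    linear_combination -htr

/-- Every nontrivial unipotent element of `SL₂` is conjugate to a lower unipotent matrix. -/
lemma exists_isConj_lowerUnipotent {A : SpecialLinearGroup (Fin 2) K}
    (htr : A 0 0 + A 1 1 = 2) (hA : A ≠ 1) : ∃ e : K, e ≠ 0 ∧ IsConj (lowerUnipotent e) A := by
  by_cases hc : A 1 0 = 0
  · have hdet := det_fin_two_eq_one A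
    have h₀ : A 0 0 = 1 := by
      have : (A 0 0 - 1) ^ 2 = 0 := by linear_combination (A 0 0) * htr - hdet - A 0 1 * hc
      linear_combination pow_eq_zero_iff two_ne_zero |>.mp this
    have h₁ : A 1 1 = 1 := by linear_combination htr - h₀
    have hb : A 0 1 ≠ 0 := fun hb => hA <| by
      refine fin_two_ext ?_ ?_ ?_ ?_ <;> simp [h₀, h₁, hb, hc]
    let w : SpecialLinearGroup (Fin 2) K := ⟨!![0, 1; -1, 0], by simp⟩
    have hw : (w : Matrix (Fin 2) (Fin 2) K) = !![0, 1; -1, 0] := rfl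
    refine ⟨-A 0 1, neg_ne_zero.mpr hb, isConj_iff.mpr ⟨w, ?_⟩⟩
    rw [mul_inv_eq_iff_eq_mul]
    refine fin_two_ext ?_ ?_ ?_ ?_ <;>
      simp [coe_lowerUnipotent, hw, mul_apply, Fin.sum_univ_two, h₀, h₁, hc]
  · exact ⟨_, hc, isConj_lowerUnipotent_of_trace_eq_two htr hc⟩

lemma diagUnit_conj_upperUnipotent (t : Kˣ) (u : K) :
    diagUnit t * upperUnipotent u * diagUnit t⁻¹ = upperUnipotent (u * (t * t)) := by
  refine fin_two_ext ?_ ?_ ?_ ?_ <;> simp [coe_upperUnipotent, coe_diagUnit]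
  ring

end Elementary

section Generation

variable {K : Type*} [Field K] {G : Subgroup (SpecialLinearGroup (Fin 2) K)}

/-- If every element is a square up to sign, a subgroup containing the diagonal torus and one
nontrivial upper unipotent element contains all of them. -/
lemma upperUnipotent_mem (hsq : ∀ z : K, IsSquare z ∨ IsSquare (-z))
    (hD : ∀ t : Kˣ, diagUnit t ∈ G) {u : K} (hu : u ≠ 0) (huG : upperUnipotent u ∈ G) (z : K) :
    upperUnipotent z ∈ G := by
  have key (r : K) : upperUnipotent (u * (r * r)) ∈ G := by
    obtain rfl | hr := eq_or_ne r 0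
    · simp [upperUnipotent_zero]
    · have := G.mul_mem (G.mul_mem (hD (Units.mk0 r hr)) huG) (hD (Units.mk0 r hr)⁻¹)
      rwa [diagUnit_conj_upperUnipotent] at this
  obtain ⟨r, hr⟩ | ⟨r, hr⟩ := hsq (u⁻¹ * z)
  · have := key r
    rwa [← hr, mul_inv_cancel_left₀ hu] at this
  · have := G.inv_mem (key r)
    rwa [← hr, upperUnipotent_inv, mul_neg, neg_neg, mul_inv_cancel_left₀ hu] at this

lemma diagUnit_smul_mem_orbit (hD : ∀ t : Kˣ, diagUnit t ∈ G) {t s x y : K}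
    (ht : t ≠ 0) (hs : s ≠ 0) (h : ![x, y] ∈ MulAction.orbit G ![(1 : K), 0]) :
    ![t * s * x, t * s⁻¹ * y] ∈ MulAction.orbit G ![(1 : K), 0] := by
  obtain ⟨g, hg⟩ := h
  refine ⟨⟨_, hD (Units.mk0 s hs)⟩ * g * ⟨_, hD (Units.mk0 t ht)⟩, ?_⟩
  have h₁ : diagUnit (Units.mk0 t ht) • ![(1 : K), 0] = t • ![(1 : K), 0] := by
    simp [diagUnit_smul]
  change (g : SpecialLinearGroup (Fin 2) K) • ![(1 : K), 0] = _ at hg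
  change (diagUnit (Units.mk0 s hs) * (g : SpecialLinearGroup (Fin 2) K) *
    diagUnit (Units.mk0 t ht)) • ![(1 : K), 0] = _
  rw [mul_smul, mul_smul, h₁, smul_comm _ t, smul_comm _ t, hg, diagUnit_smul]
  simp [mul_assoc]

/-- The orbit of the first basis vector under a subgroup containing the diagonal torus contains,
with a vector off the coordinate axes, all those whose product of coordinates is in the same
square class. -/
lemma mem_orbit_of_isSquare (hD : ∀ t : Kˣ, diagUnit t ∈ G) {x y x' y' : K}
    (hx : x ≠ 0) (hy : y ≠ 0) (hx' : x' ≠ 0) (hy' : y' ≠ 0) (hsq : IsSquare (x * y * (x' * y')))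
    (h : ![x, y] ∈ MulAction.orbit G ![(1 : K), 0]) :
    ![x', y'] ∈ MulAction.orbit G ![(1 : K), 0] := by
  obtain ⟨r, hr⟩ := hsq
  have hr₀ : r ≠ 0 := by
    rintro rfl
    simp_all
  have := diagUnit_smul_mem_orbit hD (t := r / (x * y)) (s := x' * y / r) (by positivity)
    (by positivity) h
  convert this using 2
  · field_simp
  · congr 1
    field_simp
    linear_combination hr

/-- A subgroup containing the diagonal torus and the upper unipotent matrices is everything if it
moves the first basis vector to the second. -/
lemma eq_top_of_upperUnipotent_mem (hD : ∀ t : Kˣ, diagUnit t ∈ G)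
    (hU : ∀ u : K, upperUnipotent u ∈ G)
    (h : ![(0 : K), 1] ∈ MulAction.orbit G ![(1 : K), 0]) : G = ⊤ := by
  have horb (x y : K) (hxy : x ≠ 0 ∨ y ≠ 0) : ![x, y] ∈ MulAction.orbit G ![(1 : K), 0] := by
    obtain rfl | hy := eq_or_ne y 0
    · have hx : x ≠ 0 := by simpa using hxy
      simpa using diagUnit_smul_mem_orbit hD hx one_ne_zero (MulAction.mem_orbit_self ![(1 : K), 0])
    · have h₁ := diagUnit_smul_mem_orbit hD hy one_ne_zero h
      have h₂ := MulAction.mem_orbit_of_mem_orbit (⟨_, hU (x / y)⟩ : G) h₁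
      change upperUnipotent (x / y) • ![y * 1 * 0, y * 1⁻¹ * 1] ∈ _ at h₂
      rw [upperUnipotent_smul] at h₂
      simpa [hy] using h₂
  rw [eq_top_iff]
  intro A _
  obtain ⟨g, hg⟩ := horb (A 0 0) (A 1 0) (by
    by_contra! hA
    have := det_fin_two_eq_one A
    simp [hA.1, hA.2] at this)
  change (g : SpecialLinearGroup (Fin 2) K) • ![(1 : K), 0] = _ at hg
  have h₁ : ((g : SpecialLinearGroup (Fin 2) K)⁻¹ * A) • ![(1 : K), 0] = ![1, 0] := by
    rw [mul_smul, inv_smul_eq_iff, hg, smul_fin_two]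
    simp
  have h₂ := hU (((g : SpecialLinearGroup (Fin 2) K)⁻¹ * A) 0 1)
  rw [← eq_upperUnipotent_of_smul_eq h₁] at h₂
  simpa using G.mul_mem g.2 h₂

end Generation

section Counting

variable {K : Type*} [Field K] [Fintype K]

/-- Orbit sizes of subgroups of `SL₂` divide the order of `GL₂`. -/
lemma card_orbit_dvd (G : Subgroup (SpecialLinearGroup (Fin 2) K)) (v : Fin 2 → K) :
    Nat.card (MulAction.orbit G v) ∣
      (Fintype.card K ^ 2 - 1) * (Fintype.card K ^ 2 - Fintype.card K) := by
  have h₁ : Nat.card (MulAction.orbit G v) ∣ Nat.card G := by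
    rw [Nat.card_coe_set_eq, ← MulAction.index_stabilizer]
    exact Subgroup.index_dvd_card _
  have h₂ : Nat.card (SpecialLinearGroup (Fin 2) K) ∣ Nat.card (GL (Fin 2) K) :=
    Subgroup.card_dvd_of_injective toGL toGL_injective
  have h₃ := card_GL_field (𝔽 := K) 2
  simp only [Fin.prod_univ_two, Fin.val_zero, Fin.val_one, pow_zero, pow_one] at h₃
  rw [← h₃]
  exact (h₁.trans G.card_subgroup_dvd_card).trans h₂

/-- The size of a set of vectors which contains the nonzero vectors on the coordinate axes and,
off the axes, exactly one of each pair `(x, y)`, `(-x, y)`. -/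
lemma two_mul_card_of_neg_fst [DecidableEq K] (S : Set (Fin 2 → K)) (h₀ : ![0, 0] ∉ S)
    (hx : ∀ x : K, x ≠ 0 → ![x, 0] ∈ S) (hy : ∀ y : K, y ≠ 0 → ![0, y] ∈ S)
    (hxy : ∀ x y : K, x ≠ 0 → y ≠ 0 → (![-x, y] ∈ S ↔ ![x, y] ∉ S)) :
    2 * Nat.card S = (Fintype.card K - 1) * (Fintype.card K + 3) := by
  classical
  have h₁ : Nat.card S = ∑ x : K, ∑ y : K, if ![x, y] ∈ S then 1 else 0 := by
    rw [Nat.card_eq_fintype_card, Fintype.card_subtype, Finset.card_filter,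
      ← (finTwoArrowEquiv K).symm.sum_comp, Fintype.sum_prod_type]
    rfl
  have h₂ : Nat.card S = ∑ x : K, ∑ y : K, if ![-x, y] ∈ S then 1 else 0 := by
    rw [h₁]
    exact (Fintype.sum_equiv (Equiv.neg K) _ _ fun x => rfl).symm
  have h₃ (x y : K) : ((if ![x, y] ∈ S then 1 else 0) + if ![-x, y] ∈ S then 1 else 0) =
      if x = 0 then (if y = 0 then 0 else 2) else if y = 0 then 2 else 1 := by
    by_cases hx0 : x = 0 <;> by_cases hy0 : y = 0
    · simp [hx0, hy0, h₀]
    · simp [hx0, hy0, hy]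
    · simp [hx0, hy0, hx]
    · by_cases h : ![x, y] ∈ S <;> simp [hx0, hy0, hxy, h]
  have hpos : 1 ≤ Fintype.card K := Fintype.card_pos
  rw [two_mul]
  nth_rewrite 1 [h₁]
  rw [h₂]
  simp only [← Finset.sum_add_distrib, h₃]
  have h₄ (x : K) : (∑ y : K, if x = 0 then (if y = 0 then 0 else 2) else if y = 0 then 2 else 1) =
      if x = 0 then 2 * (Fintype.card K - 1) else Fintype.card K + 1 := by
    split_ifs
    · simp [Finset.sum_ite, Finset.filter_ne', Finset.card_erase_of_mem, mul_comm]
    · simp [Finset.sum_ite, Finset.filter_ne', Finset.card_erase_of_mem, Finset.filter_eq']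
      omega
  simp only [h₄]
  simp [Finset.sum_ite, Finset.filter_ne', Finset.card_erase_of_mem, Finset.filter_eq']
  ring

end Counting

section Main

variable {K : Type*} [Field K] [Fintype K]

lemma isSquare_or_isSquare_neg (hK : Fintype.card K % 4 = 3) (z : K) :
    IsSquare z ∨ IsSquare (-z) := by
  classical
  by_contra! h
  have h₁ := quadraticChar_neg_one_iff_not_isSquare.mpr h.1
  have h₂ := quadraticChar_neg_one_iff_not_isSquare.mpr h.2
  have h₃ : ¬ IsSquare (-1 : K) := by
    rw [FiniteField.isSquare_neg_one_iff]
    omega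
  rw [← neg_one_mul, map_mul, h₁, quadraticChar_neg_one_iff_not_isSquare.mpr h₃] at h₂
  norm_num at h₂

/-- A subgroup of `SL₂` over a finite field of order `3` modulo `4` which contains the diagonal
torus and a unipotent element without zero entries off the diagonal and in the lower right corner
is everything, apart from some small fields. -/
lemma eq_top_of_diagUnit_mem (hK : Fintype.card K % 4 = 3) (hK' : ¬ Fintype.card K + 3 ∣ 48)
    {G : Subgroup (SpecialLinearGroup (Fin 2) K)} (hD : ∀ t : Kˣ, diagUnit t ∈ G)
    {A : SpecialLinearGroup (Fin 2) K} (hA : A ∈ G) (htr : A 0 0 + A 1 1 = 2)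
    (hb : A 0 1 ≠ 0) (hc : A 1 0 ≠ 0) (hd : A 1 1 ≠ 0) : G = ⊤ := by
  classical
  have hdet := det_fin_two_eq_one A
  have hsq := isSquare_or_isSquare_neg hK
  have hneg : ¬ IsSquare (-1 : K) := by
    rw [FiniteField.isSquare_neg_one_iff]
    omega
  have h2 : (2 : K) ≠ 0 := fun h => hneg ⟨1, by linear_combination -h⟩
  have hbc : (A 0 0 - A 1 1) ^ 2 = -4 * (A 0 1 * A 1 0) := by
    linear_combination (A 0 0 + A 1 1 + 2) * htr - 4 * hdet
  have had : A 0 0 - A 1 1 ≠ 0 := by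
    intro h
    rw [h] at hbc
    have : (2 : K) * 2 * (A 0 1 * A 1 0) = 0 := by linear_combination hbc
    simp_all
  have hsmul {g : SpecialLinearGroup (Fin 2) K} (hg : g ∈ G) {v : Fin 2 → K}
      (hv : v ∈ MulAction.orbit G ![(1 : K), 0]) : g • v ∈ MulAction.orbit G ![(1 : K), 0] :=
    MulAction.mem_orbit_of_mem_orbit (⟨g, hg⟩ : G) hv
  have hone := MulAction.mem_orbit_self (M := G) ![(1 : K), 0]
  have hdc : ![A 1 1, -A 1 0] ∈ MulAction.orbit G ![(1 : K), 0] := by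
    convert hsmul (G.inv_mem hA) hone using 1
    rw [eq_inv_smul_iff, smul_fin_two]
    congr 1
    · linear_combination hdet
    · congr 1
      ring
  have hbd : ![A 0 1, A 1 1] ∈ MulAction.orbit G ![(1 : K), 0] := by
    refine mem_orbit_of_isSquare hD hd (neg_ne_zero.mpr hc) hb hd
      ⟨A 1 1 * ((A 0 0 - A 1 1) / 2), ?_⟩ hdc
    field_simp
    linear_combination -hbc
  have h01 : ![(0 : K), 1] ∈ MulAction.orbit G ![(1 : K), 0] := by
    convert hsmul (G.inv_mem hA) hbd using 1
    rw [eq_inv_smul_iff, smul_fin_two]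
    simp
  by_cases hfix : ![A 0 0 - A 1 1, 2 * A 1 0] ∈ MulAction.orbit G ![(1 : K), 0]
  · obtain ⟨g, hg⟩ := hfix
    change (g : SpecialLinearGroup (Fin 2) K) • ![(1 : K), 0] = _ at hg
    set B := (g : SpecialLinearGroup (Fin 2) K)⁻¹ * A * g with hB
    have hBG : B ∈ G := G.mul_mem (G.mul_mem (G.inv_mem g.2) hA) g.2
    have hBfix : B • ![(1 : K), 0] = ![1, 0] := by
      rw [hB, mul_smul, mul_smul, inv_smul_eq_iff, hg, smul_fin_two]
      congr 1
      · linear_combination (A 0 0 + 1) * htr - 2 * hdet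
      · congr 1
        linear_combination A 1 0 * htr
    have hBu := eq_upperUnipotent_of_smul_eq hBfix
    refine eq_top_of_upperUnipotent_mem hD (upperUnipotent_mem hsq hD ?_ (hBu ▸ hBG)) h01
    intro h
    rw [h, upperUnipotent_zero, hB, mul_assoc, inv_mul_eq_one, right_eq_mul] at hBu
    simp [hBu] at hc
  · have hcard : 2 * Nat.card (MulAction.orbit G ![(1 : K), 0]) =
        (Fintype.card K - 1) * (Fintype.card K + 3) := by
      refine two_mul_card_of_neg_fst _ ?_ (fun x hx => ?_) (fun y hy => ?_) fun x y hx hy => ?_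
      · rintro ⟨g, hg⟩
        change (g : SpecialLinearGroup (Fin 2) K) • ![(1 : K), 0] = _ at hg
        rw [← eq_inv_smul_iff, smul_fin_two] at hg
        simpa using congrFun hg 0
      · simpa using diagUnit_smul_mem_orbit hD hx one_ne_zero hone
      · simpa using diagUnit_smul_mem_orbit hD hy one_ne_zero h01
      · have hc' : 2 * A 1 0 ≠ 0 := mul_ne_zero h2 hc
        have hx' := neg_ne_zero.mpr hx
        constructor
        · intro h₁ h₂
          obtain h | h := hsq (x * y * ((A 0 0 - A 1 1) * (2 * A 1 0)))
          · exact hfix (mem_orbit_of_isSquare hD hx hy had hc' h h₂)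
          · exact hfix (mem_orbit_of_isSquare hD hx' hy had hc' (by simpa using h) h₁)
        · intro h₁
          obtain h | h := hsq (A 1 1 * -A 1 0 * (x * y))
          · exact absurd (mem_orbit_of_isSquare hD hd (neg_ne_zero.mpr hc) hx hy h hdc) h₁
          · exact mem_orbit_of_isSquare hD hd (neg_ne_zero.mpr hc) hx' hy (by simpa using h) hdc
    have hdvd := mul_dvd_mul_left 2 (card_orbit_dvd G ![(1 : K), 0])
    rw [hcard] at hdvd
    exfalso
    obtain ⟨n, hn⟩ : ∃ n, Fintype.card K = n + 2 := ⟨Fintype.card K - 2, by omega⟩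
    rw [hn] at hdvd hK'
    have e₁ : (n + 2) ^ 2 - 1 = (n + 1) * (n + 3) := by
      rw [Nat.sub_eq_iff_eq_add (Nat.one_le_pow _ _ (by omega))]
      ring
    have e₂ : (n + 2) ^ 2 - (n + 2) = (n + 1) * (n + 2) := by
      rw [Nat.sub_eq_iff_eq_add (Nat.le_self_pow two_ne_zero _)]
      ring
    rw [e₁, e₂, show n + 2 - 1 = n + 1 by omega,
      show 2 * ((n + 1) * (n + 3) * ((n + 1) * (n + 2))) =
      (n + 1) * (2 * (n + 3) * ((n + 1) * (n + 2))) by ring] at hdvd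
    have hdvd' := Nat.dvd_of_mul_dvd_mul_left (Nat.succ_pos n) hdvd
    apply hK'
    zify at hdvd' ⊢
    have e₃ : (48 : ℤ) = (n + 2 + 3) * (2 * n ^ 2 + 2 * n + 12) -
        2 * (n + 3) * ((n + 1) * (n + 2)) := by ring
    rw [e₃]
    exact (dvd_mul_right _ _).sub hdvd'

/-- In characteristic three, `SL₂` over a field of order `3` modulo `4` is generated by two
conjugates of any nontrivial lower unipotent matrix, apart from some small fields. -/
lemma exists_isConj_closure_eq_top [CharP K 3] (hK : Fintype.card K % 4 = 3)
    (hK' : ¬ Fintype.card K + 3 ∣ 48) {e : K} (he : e ≠ 0) :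
    ∃ A B : SpecialLinearGroup (Fin 2) K, IsConj (lowerUnipotent e) A ∧
      IsConj (lowerUnipotent e) B ∧ Subgroup.closure {A, B} = ⊤ := by
  have h3 : (3 : K) = 0 := by exact_mod_cast CharP.cast_eq_zero K 3
  have hsq := isSquare_or_isSquare_neg hK
  obtain ⟨m, hm⟩ := IsCyclic.exists_generator (α := Kˣ)
  have hneg : ¬ IsSquare (-1 : K) := by
    rw [FiniteField.isSquare_neg_one_iff]
    omega
  have hm_pow (t : Kˣ) : ∃ k : ℤ, m ^ k = t := Subgroup.mem_zpowers_iff.mp (hm t)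
  have hm_nsq : ¬ IsSquare (m : K) := by
    rintro ⟨r, hr⟩
    apply hneg
    obtain ⟨k, hk⟩ := hm_pow (-1)
    have : (m : K) ^ k = -1 := by
      rw [← Units.val_zpow_eq_zpow_val, hk, Units.val_neg, Units.val_one]
    exact ⟨r ^ k, by rw [← this, hr, mul_zpow]⟩
  obtain ⟨s, hs⟩ := (hsq m).resolve_left hm_nsq
  have hs₀ : s ≠ 0 := by
    rintro rfl
    simp at hs
  have hm₁ : 1 - (m : K) ≠ 0 := fun h => hm_nsq ⟨1, by linear_combination -h⟩
  have hm₂ : 1 + (m : K) ≠ 0 := by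
    intro h
    have hord := orderOf_eq_card_of_forall_mem_zpowers hm
    have hdvd : orderOf m ∣ 2 := by
      refine orderOf_dvd_of_pow_eq_one (Units.ext ?_)
      push_cast
      linear_combination ((m : K) - 1) * h
    rw [hord, Nat.card_units, Nat.card_eq_fintype_card] at hdvd
    have hle := Nat.le_of_dvd two_pos hdvd
    have : Fintype.card K = 3 := by omega
    norm_num [this] at hK'
  obtain ⟨A, hAe⟩ : ∃ A : SpecialLinearGroup (Fin 2) K, (A : Matrix (Fin 2) (Fin 2) K) =
      !![-(m : K) / (1 + (m : K)), -(1 - (m : K)) ^ 2 / ((1 + (m : K)) ^ 2 * e);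
         e, -1 / (1 + (m : K))] := by
    refine ⟨⟨_, ?_⟩, rfl⟩
    rw [det_fin_two_of]
    field_simp
    linear_combination (-m : K) * h3
  have htr : A 0 0 + A 1 1 = 2 := by
    simp only [hAe, of_apply, cons_val', cons_val_zero, cons_val_one, cons_val_fin_one]
    field_simp
    linear_combination (-1 - m : K) * h3
  have hA₁₀ : A 1 0 = e := by simp [hAe]
  have hBtr : (A⁻¹ * diagUnit m) 0 0 + (A⁻¹ * diagUnit m) 1 1 = 2 := by
    simp [coe_inv, adjugate_fin_two, mul_apply, Fin.sum_univ_two, hAe, coe_diagUnit]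
    field_simp
    linear_combination (-1 - m : K) * h3
  have hB₁₀ : (A⁻¹ * diagUnit m) 1 0 = e * (s * s) := by
    simp [coe_inv, adjugate_fin_two, mul_apply, Fin.sum_univ_two, hAe, coe_diagUnit, ← hs]
  refine ⟨A, A⁻¹ * diagUnit m, ?_, ?_, ?_⟩
  · exact hA₁₀ ▸ isConj_lowerUnipotent_of_trace_eq_two htr (hA₁₀ ▸ he)
  · refine (isConj_lowerUnipotent_mul_sq e hs₀).symm.trans ?_
    rw [← hB₁₀]
    exact isConj_lowerUnipotent_of_trace_eq_two hBtr (by rw [hB₁₀]; positivity)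
  · have hAG : A ∈ Subgroup.closure {A, A⁻¹ * diagUnit m} := Subgroup.subset_closure (by simp)
    have hBG : A⁻¹ * diagUnit m ∈ Subgroup.closure {A, A⁻¹ * diagUnit m} :=
      Subgroup.subset_closure (by simp)
    refine eq_top_of_diagUnit_mem hK hK' (fun t => ?_) hAG htr ?_ (hA₁₀ ▸ he) ?_
    · obtain ⟨k, rfl⟩ := hm_pow t
      rw [map_zpow]
      exact Subgroup.zpow_mem _ (by simpa using Subgroup.mul_mem _ hAG hBG) k
    · simp [hAe, hm₁, hm₂, he]
    · simp [hAe, hm₂]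

/-- A nontrivial unipotent element of `SL₂` generates the group together with a suitable
conjugate. -/
theorem exists_closure_conj_eq_top_of_trace_eq_two [CharP K 3] (hK : Fintype.card K % 4 = 3)
    (hK' : ¬ Fintype.card K + 3 ∣ 48) {X : SpecialLinearGroup (Fin 2) K}
    (htr : X 0 0 + X 1 1 = 2) (hX : X ≠ 1) :
    ∃ g : SpecialLinearGroup (Fin 2) K, Subgroup.closure {X, g⁻¹ * X * g} = ⊤ := by
  obtain ⟨e, he, hXe⟩ := exists_isConj_lowerUnipotent htr hX
  obtain ⟨A, B, hA, hB, hAB⟩ := exists_isConj_closure_eq_top hK hK' he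
  obtain ⟨h, rfl⟩ := isConj_iff.mp (hXe.symm.trans hA)
  obtain ⟨k, rfl⟩ := isConj_iff.mp (hXe.symm.trans hB)
  refine ⟨k⁻¹ * h, ?_⟩
  have := congrArg (Subgroup.map (MulAut.conj h⁻¹).toMonoidHom) hAB
  rw [MonoidHom.map_closure, Subgroup.map_top_of_surjective _ (MulAut.conj h⁻¹).surjective,
    Set.image_pair] at this
  simpa [mul_assoc] using this

/-- In characteristic three, an element of `SL₂` of order dividing three has trace two. -/
lemma trace_eq_two_of_pow_three_eq_one {K : Type*} [Field K] [CharP K 3]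
    {X : SpecialLinearGroup (Fin 2) K} (hX : X ^ 3 = 1) : X 0 0 + X 1 1 = 2 := by
  have h₁ : ((X : Matrix (Fin 2) (Fin 2) K) - 1) ^ 3 = 0 := by
    have hX' : (X : Matrix (Fin 2) (Fin 2) K) ^ 3 = 1 := by rw [← coe_pow, hX, coe_one]
    have : Fact (Nat.Prime 3) := ⟨Nat.prime_three⟩
    rw [sub_pow_char_of_commute (p := 3) (Commute.one_right _), hX', one_pow, sub_self]
  have h₂ : ((X : Matrix (Fin 2) (Fin 2) K) - 1).det = 0 := by
    rw [← pow_eq_zero_iff three_ne_zero, ← det_pow, h₁, det_zero]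
  rw [det_fin_two] at h₂
  simp at h₂
  linear_combination det_fin_two_eq_one X - h₂

/-- An element of order three of `PSL₂` in characteristic three generates the group together with
a suitable conjugate. -/
theorem _root_.Matrix.ProjectiveSpecialLinearGroup.exists_closure_conj_eq_top [CharP K 3]
    (hK : Fintype.card K % 4 = 3) (hK' : ¬ Fintype.card K + 3 ∣ 48)
    {x : ProjectiveSpecialLinearGroup (Fin 2) K} (hx : orderOf x = 3) :
    ∃ g : ProjectiveSpecialLinearGroup (Fin 2) K,
      Subgroup.closure {x, g⁻¹ * x * g} = ⊤ := by
  obtain ⟨Y, rfl⟩ := QuotientGroup.mk_surjective x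
  have hx3 := pow_orderOf_eq_one (QuotientGroup.mk' (Subgroup.center _) Y)
  change orderOf (QuotientGroup.mk' (Subgroup.center _) Y) = 3 at hx
  rw [hx] at hx3
  have hY : Y ^ 3 ∈ Subgroup.center _ := by
    rwa [← map_pow, QuotientGroup.mk'_apply, QuotientGroup.eq_one_iff] at hx3
  have hYX : QuotientGroup.mk' (Subgroup.center _) (Y ^ 4) = QuotientGroup.mk' _ Y := by
    rw [map_pow, pow_succ, hx3, one_mul]
  have hX3 : (Y ^ 4) ^ 3 = 1 := by
    obtain ⟨r, hr, hr'⟩ := mem_center_iff.mp hY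
    have h₁ : (Y ^ 3) ^ 2 = 1 := by
      apply Subtype.val_injective
      change ((Y ^ 3) ^ 2 : SpecialLinearGroup (Fin 2) K).1 = 1
      rw [coe_pow, ← hr', ← map_pow]
      rw [Fintype.card_fin] at hr
      rw [hr, map_one]
    calc (Y ^ 4) ^ 3 = ((Y ^ 3) ^ 2) ^ 2 := by simp only [← pow_mul]
      _ = 1 := by rw [h₁, one_pow]
  have hX1 : Y ^ 4 ≠ 1 := by
    intro h
    rw [← hYX, h, map_one, orderOf_one] at hx
    norm_num at hx
  obtain ⟨g, hg⟩ := exists_closure_conj_eq_top_of_trace_eq_two hK hK'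
    (trace_eq_two_of_pow_three_eq_one hX3) hX1
  refine ⟨g, ?_⟩
  have := congrArg (Subgroup.map (QuotientGroup.mk' (Subgroup.center _))) hg
  rw [MonoidHom.map_closure, Subgroup.map_top_of_surjective _ (QuotientGroup.mk'_surjective _),
    Set.image_pair] at this
  rwa [map_mul, map_mul, map_inv, hYX] at this

end Main

end Matrix.SpecialLinearGroup

theorem psl2_char3_unipotent_generation
    (a : ℕ) (ha : a.Prime) (hodd : Odd a)
    (x : Matrix.ProjectiveSpecialLinearGroup (Fin 2) (GaloisField 3 a))
    (hx : orderOf x = 3) :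
    ∃ g : Matrix.ProjectiveSpecialLinearGroup (Fin 2) (GaloisField 3 a),
      Subgroup.closure
        ({x, g⁻¹ * x * g} :
          Set (Matrix.ProjectiveSpecialLinearGroup (Fin 2) (GaloisField 3 a))) = ⊤ := by
  have := Fintype.ofFinite (GaloisField 3 a)
  have hcard : Fintype.card (GaloisField 3 a) = 3 ^ a := by
    rw [← Nat.card_eq_fintype_card, GaloisField.card 3 a ha.ne_zero]
  obtain ⟨k, rfl⟩ := hodd
  have hk : k ≠ 0 := by
    rintro rfl
    exact Nat.not_prime_one ha
  have hK : Fintype.card (GaloisField 3 (2 * k + 1)) % 4 = 3 := by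
    rw [hcard, pow_succ, pow_mul, Nat.mul_mod, Nat.pow_mod]
    norm_num
  have hK' : ¬ Fintype.card (GaloisField 3 (2 * k + 1)) + 3 ∣ 48 := by
    rw [hcard]
    intro h
    obtain rfl | hk₂ : k = 1 ∨ 2 ≤ k := by omega
    · norm_num at h
    · have h₁ := Nat.le_of_dvd (by norm_num) h
      have h₂ : 3 ^ 5 ≤ 3 ^ (2 * k + 1) := Nat.pow_le_pow_right (by norm_num) (by omega)
      linarith
  exact Matrix.ProjectiveSpecialLinearGroup.exists_closure_conj_eq_top hK hK' hx
end
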